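/- arXiv:2211.13872 — 2 statements merged into one kernel-verified Lean document; each statement's English description precedes it below -/
import Mathlib

section
/- Let $\bar f:[0,1]\to[0,\infty)$ be a smooth concave function with $\bar f(0)=\bar f(1)=0$ and $r\bar f'(r)\to 0$ as $r\to 0^+$. Let $g:\mathbb R\to\mathbb R$ be a smooth $\tfrac{\pi}{2}$-periodic function with $\int_0^{\pi/2} g(\theta)\,d\theta=0$. Let $f:[0,1]\to\mathbb R$ be continuous with $|f(r)|\le \bar f(r)$ for all $r\in[0,1]$. Then there exists a function $\psi:\mathbb R^2\to\mathbb R$ which is twice continuously differentiable on the closed unit ball and satisfies $\partial_{x_1}^2\psi(x)+\partial_{x_2}^2\psi(x) = f(|x|)\,g(\theta(x))$ for every $x$ with $0<|x|\le 1$, where $\theta(x)$ denotes the polar angle of $x$ (any determination of the angle, since $g$ is $2\pi$-periodic). -/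
open Real MeasureTheory Set

theorem abs_integral_pow_mul_le {f : ℝ → ℝ} {C r : ℝ} (m k : ℕ) (hr : 0 ≤ r)
    (hf : ∀ ρ, 0 ≤ ρ → |ρ ^ m * f ρ| ≤ C * ρ ^ k) :
    |∫ ρ in (0:ℝ)..r, ρ ^ m * f ρ| ≤ C * (r ^ (k + 1) / (k + 1)) := by
  have h := intervalIntegral.norm_integral_le_of_norm_le (μ := volume) (a := 0) (b := r)
    (f := fun ρ => ρ ^ m * f ρ) (g := fun ρ => C * ρ ^ k) hr
    (Filter.Eventually.of_forall fun ρ hρ => hf ρ hρ.1.le)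
    (by apply Continuous.intervalIntegrable; fun_prop)
  simpa [integral_pow] using h

theorem abs_integral_exp_mul_le {F : ℝ → ℝ} {C c t : ℝ} (hc : 0 < c) (hC : 0 ≤ C) (ht : t ≤ 0)
    (hF : ∀ s, |F s| ≤ C * exp (-c * s)) :
    |∫ s in t..0, F s| ≤ C * exp (-c * t) / c := by
  have h := intervalIntegral.norm_integral_le_of_norm_le (μ := volume) (a := t) (b := 0)
    (f := F) (g := fun s => C * exp (-c * s)) ht
    (Filter.Eventually.of_forall fun s _ => hF s)
    (by apply Continuous.intervalIntegrable; fun_prop)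
  have h2 : ∫ s in t..0, C * exp (-c * s) = -C * exp (-c * 0) / c - -C * exp (-c * t) / c := by
    refine intervalIntegral.integral_eq_sub_of_hasDerivAt
      (f := fun s => -C * exp (-c * s) / c) (fun s _ => ?_)
      (by apply Continuous.intervalIntegrable; fun_prop)
    have h3 := ((((hasDerivAt_id s).const_mul (-c)).exp).const_mul (-C)).div_const c
    convert! h3 using 1
    simp; field_simp
  rw [h2, Real.norm_eq_abs] at h
  refine h.trans ?_
  have : 0 ≤ C / c := by positivity
  simp only [mul_zero, exp_zero]
  have e : -C * 1 / c - -C * exp (-c * t) / c = C * exp (-c * t) / c - C / c := by ring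
  linarith

theorem exists_radial_solution {f : ℝ → ℝ} {C : ℝ} (hC : 0 ≤ C) (hf : Continuous f)
    (hf1 : ∀ ρ, 1 ≤ ρ → f ρ = 0) (hfC : ∀ ρ, 0 ≤ ρ → |f ρ| ≤ C * ρ) (N : ℕ) (hN : 4 ≤ N) :
    ∃ U U' : ℝ → ℝ, (∀ t, HasDerivAt U (U' t) t) ∧
      (∀ t, HasDerivAt U' ((N:ℝ) ^ 2 * U t + exp t ^ 2 * f (exp t)) t) ∧
      (∀ t, (N:ℝ) ^ 2 * |U t| ≤ 5 * C) ∧ (∀ t, (N:ℝ) * |U' t| ≤ 5 * C) ∧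
      (∀ t, (N:ℝ) ^ 2 * |U t| ≤ 5 * C * exp t ^ 3) ∧
      (∀ t, (N:ℝ) * |U' t| ≤ 5 * C * exp t ^ 3) := by
  have hN' : (4:ℝ) ≤ N := by exact_mod_cast hN
  set J : ℝ → ℝ := fun r => ∫ ρ in (0:ℝ)..r, ρ ^ (N + 1) * f ρ with hJ
  set A : ℝ → ℝ := fun t => exp (-N * t) * J (exp t) with hA
  set I : ℝ → ℝ := fun t => ∫ s in t..0, exp (-N * s) * (exp s ^ 2 * f (exp s)) with hI
  set B : ℝ → ℝ := fun t => exp (N * t) * I t with hB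
  have hexpN : ∀ t : ℝ, exp (-N * t) * exp t ^ N = 1 := by
    intro t
    rw [← Real.exp_nat_mul, ← Real.exp_add]; simp
  have hexpN' : ∀ t : ℝ, exp (N * t) * exp (-N * t) = 1 := by
    intro t
    rw [← Real.exp_add]; simp
  have dA : ∀ t, HasDerivAt A (-N * A t + exp t ^ 2 * f (exp t)) t := by
    intro t
    have h1 : HasDerivAt J (exp t ^ (N + 1) * f (exp t)) (exp t) := by
      have hc : Continuous fun ρ : ℝ => ρ ^ (N + 1) * f ρ := by fun_prop
      exact intervalIntegral.integral_hasDerivAt_right (hc.intervalIntegrable _ _)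
        hc.stronglyMeasurable.stronglyMeasurableAtFilter hc.continuousAt
    have h2 := (((hasDerivAt_id t).const_mul (-(N:ℝ))).exp).mul (h1.comp t (Real.hasDerivAt_exp t))
    convert! h2 using 1
    simp only [hA, id, Function.comp]
    linear_combination (-exp t ^ 2 * f (exp t)) * hexpN t
  have dB : ∀ t, HasDerivAt B (N * B t - exp t ^ 2 * f (exp t)) t := by
    intro t
    have h1 : HasDerivAt I (-(exp (-N * t) * (exp t ^ 2 * f (exp t)))) t := by
      have hc : Continuous fun s : ℝ => exp (-N * s) * (exp s ^ 2 * f (exp s)) := by fun_prop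
      exact intervalIntegral.integral_hasDerivAt_left (hc.intervalIntegrable _ _)
        hc.stronglyMeasurable.stronglyMeasurableAtFilter hc.continuousAt
    have h2 := (((hasDerivAt_id t).const_mul (N:ℝ)).exp).mul h1
    convert! h2 using 1
    simp only [hB, id]
    linear_combination (exp t ^ 2 * f (exp t)) * hexpN' t
  have bA1 : ∀ t, N * |A t| ≤ C := by
    intro t
    have h := abs_integral_pow_mul_le (f := f) (C := C) (r := exp t) (N + 1) (N - 1)
      (exp_pos t).le (by
        intro ρ hρ
        rw [abs_mul, abs_of_nonneg (by positivity)]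
        have e : ρ ^ (N + 1) = ρ ^ (N - 1) * ρ ^ 2 := by rw [← pow_add]; congr 1; omega
        have h2 : ρ ^ 2 * |f ρ| ≤ C := by
          rcases le_total 1 ρ with h1 | h1
          · simp [hf1 ρ h1, hC]
          · nlinarith [hfC ρ hρ, abs_nonneg (f ρ), mul_le_mul_of_nonneg_left h1 hC,
              pow_le_one₀ hρ h1 (n := 2), mul_le_of_le_one_left (abs_nonneg (f ρ))
                (pow_le_one₀ hρ h1 (n := 2))]
        rw [e]
        nlinarith [pow_nonneg hρ (N - 1)])
    have e1 : ((N - 1 : ℕ) : ℝ) + 1 = N := by rw [Nat.cast_sub (by omega)]; simp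
    rw [e1, Nat.sub_add_cancel (by omega)] at h
    simp only [hA]
    rw [abs_mul, abs_of_pos (exp_pos _)]
    calc N * (exp (-N * t) * |J (exp t)|) ≤ N * (exp (-N * t) * (C * (exp t ^ N / N))) := by
          gcongr
      _ = C * (exp (-N * t) * exp t ^ N) := by field_simp
      _ = C := by rw [hexpN, mul_one]
  have bA2 : ∀ t, N * |A t| ≤ C * exp t ^ 3 := by
    intro t
    have h := abs_integral_pow_mul_le (f := f) (C := C) (r := exp t) (N + 1) (N + 2)
      (exp_pos t).le (by
        intro ρ hρ
        rw [abs_mul, abs_of_nonneg (by positivity)]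
        calc ρ ^ (N + 1) * |f ρ| ≤ ρ ^ (N + 1) * (C * ρ) := by gcongr; exact hfC ρ hρ
          _ = _ := by ring)
    simp only [hA]
    rw [abs_mul, abs_of_pos (exp_pos _)]
    calc N * (exp (-N * t) * |J (exp t)|)
        ≤ N * (exp (-N * t) * (C * (exp t ^ (N + 2 + 1) / N))) := by
          have : exp t ^ (N + 2 + 1) / (((N + 2 : ℕ) : ℝ) + 1) ≤ exp t ^ (N + 2 + 1) / N := by
            gcongr; push_cast; linarith
          have h' := h.trans (mul_le_mul_of_nonneg_left this hC)
          gcongr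
      _ = C * exp t ^ 3 * (exp (-N * t) * exp t ^ N) := by field_simp; ring
      _ = C * exp t ^ 3 := by rw [hexpN, mul_one]
  have B0 : ∀ t, 0 ≤ t → B t = 0 := by
    intro t ht
    have : I t = 0 := by
      simp only [hI]
      rw [intervalIntegral.integral_symm, neg_eq_zero]
      refine (intervalIntegral.integral_congr (g := fun _ => (0:ℝ)) ?_).trans (by simp)
      intro s hs
      rw [uIcc_of_le ht] at hs
      simp [hf1 (exp s) (one_le_exp hs.1)]
    simp [hB, this]
  have bB2 : ∀ t, N * |B t| ≤ 4 * C * exp t ^ 3 := by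
    intro t
    rcases le_total 0 t with ht | ht
    · rw [B0 t ht]; simp; positivity
    · have h := abs_integral_exp_mul_le (c := N - 3) (C := C) (t := t)
        (F := fun s => exp (-N * s) * (exp s ^ 2 * f (exp s))) (by linarith) hC ht (by
          intro s
          rw [abs_mul, abs_mul, abs_of_pos (exp_pos _), abs_of_pos (by positivity)]
          calc exp (-N * s) * (exp s ^ 2 * |f (exp s)|)
              ≤ exp (-N * s) * (exp s ^ 2 * (C * exp s)) := by
                gcongr; exact hfC _ (exp_pos s).le
            _ = C * (exp (-N * s) * exp s ^ 3) := by ring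
            _ = C * exp (-(N - 3) * s) := by
                rw [← Real.exp_nat_mul, ← Real.exp_add]; congr 2; push_cast; ring)
      simp only [hB]
      rw [abs_mul, abs_of_pos (exp_pos _)]
      have e : exp (N * t) * exp (-(N - 3) * t) = exp t ^ 3 := by
        rw [← Real.exp_nat_mul, ← Real.exp_add]; congr 1; push_cast; ring
      have h3 : (0:ℝ) < N - 3 := by linarith
      calc N * (exp (N * t) * |I t|)
          ≤ N * (exp (N * t) * (C * exp (-(N - 3) * t) / (N - 3))) := by gcongr
        _ = N / (N - 3) * C * (exp (N * t) * exp (-(N - 3) * t)) := by field_simp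
        _ ≤ 4 * C * (exp (N * t) * exp (-(N - 3) * t)) := by
            gcongr
            rw [div_le_iff₀ h3]; linarith
        _ = _ := by rw [e]
  have bB1 : ∀ t, N * |B t| ≤ 4 * C := by
    intro t
    rcases le_total 0 t with ht | ht
    · rw [B0 t ht]; simp; positivity
    · exact (bB2 t).trans (mul_le_of_le_one_right (by positivity)
        (pow_le_one₀ (exp_pos t).le (exp_le_one_iff.mpr ht)))
  have hN0 : (N:ℝ) ≠ 0 := by positivity
  have key1 : ∀ t X, N * |A t| + N * |B t| ≤ X → (N:ℝ) ^ 2 * |-(A t + B t) / (2 * N)| ≤ X := by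
    intro t X h
    have h1 := abs_add_le (A t) (B t)
    rw [abs_div, abs_neg, abs_of_pos (by positivity : (0:ℝ) < 2 * N)]
    have e : (N:ℝ) ^ 2 * (|A t + B t| / (2 * N)) = N * |A t + B t| / 2 := by field_simp
    rw [e]
    have h2 : (N:ℝ) * |A t + B t| ≤ N * (|A t| + |B t|) := by gcongr
    have h3 : 0 ≤ (N:ℝ) * |A t + B t| := by positivity
    linarith
  have key2 : ∀ t X, N * |A t| + N * |B t| ≤ X → (N:ℝ) * |(A t - B t) / 2| ≤ X := by
    intro t X h
    have h1 := abs_sub (A t) (B t)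
    rw [abs_div, abs_of_pos (by positivity : (0:ℝ) < 2)]
    have h2 : (N:ℝ) * |A t - B t| ≤ N * (|A t| + |B t|) := by gcongr
    have h3 : 0 ≤ (N:ℝ) * |A t - B t| := by positivity
    linarith
  refine ⟨fun t => -(A t + B t) / (2 * N), fun t => (A t - B t) / 2, fun t => ?_, fun t => ?_,
    fun t => key1 t _ ?_, fun t => key2 t _ ?_, fun t => key1 t _ ?_, fun t => key2 t _ ?_⟩
  · have := (((dA t).add (dB t)).neg).div_const (2 * (N:ℝ))
    convert! this using 1
    field_simp; ring
  · have := ((dA t).sub (dB t)).div_const 2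
    convert! this using 1
    field_simp; ring
  · linarith [bA1 t, bB1 t]
  · linarith [bA1 t, bB1 t]
  · linarith [bA2 t, bB2 t]
  · linarith [bA2 t, bB2 t]

theorem fourierCoeffOn_eq_of_hasDerivAt_of_periodic {T : ℝ} (hT : 0 < T) {f f' : ℝ → ℂ}
    (hf : ∀ x, HasDerivAt f (f' x) x) (hf' : Continuous f') (hp : Function.Periodic f T)
    {n : ℤ} (hn : n ≠ 0) :
    fourierCoeffOn hT f n = T / (2 * π * Complex.I * n) * fourierCoeffOn hT f' n := by
  rw [fourierCoeffOn_of_hasDerivAt hT hn (fun x _ => hf x) (hf'.intervalIntegrable _ _)]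
  have : f T = f 0 := by simpa using hp 0
  rw [this]
  have hpi : (π : ℂ) ≠ 0 := by exact_mod_cast pi_ne_zero
  have hn' : (n : ℂ) ≠ 0 := by exact_mod_cast hn
  simp
  field_simp
  rw [Complex.I_sq]
  ring

theorem norm_fourierCoeffOn_le {T : ℝ} (hT : 0 < T) {f : ℝ → ℂ} {M : ℝ}
    (hM : ∀ x, ‖f x‖ ≤ M) (n : ℤ) : ‖fourierCoeffOn hT f n‖ ≤ M := by
  rw [fourierCoeffOn_eq_integral]
  have h : ‖∫ x in (0:ℝ)..T, fourier (-n) (x : AddCircle (T - 0)) • f x‖ ≤ M * |T - 0| := by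
    refine intervalIntegral.norm_integral_le_of_norm_le_const fun x _ => ?_
    rw [norm_smul, fourier_apply, Circle.norm_coe, one_mul]
    exact hM x
  rw [norm_smul]
  simp only [sub_zero, abs_of_pos hT] at h
  simp only [sub_zero, norm_div, norm_one, Real.norm_eq_abs, abs_of_pos hT]
  rw [div_mul_eq_mul_div, one_mul, div_le_iff₀ hT]
  exact h

theorem exists_hasSum_fourier {T : ℝ} (hT : 0 < T) {g : ℝ → ℂ} (hg : ContDiff ℝ 2 g)
    (hp : Function.Periodic g T) (hmean : ∫ x in (0:ℝ)..T, g x = 0) :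
    ∃ c : ℤ → ℂ, Summable (fun n => ‖c n‖) ∧ c 0 = 0 ∧
      ∀ x : ℝ, HasSum (fun n => c n * Complex.exp (2 * π * Complex.I * n * x / T)) (g x) := by
  have hg1 : ∀ x, HasDerivAt g (deriv g x) x := fun x =>
    (hg.differentiable (by norm_num)).differentiableAt.hasDerivAt
  have hd : ContDiff ℝ 1 (deriv g) := by
    have := (contDiff_succ_iff_deriv (n := 1) (f := g)).1 (by simpa [one_add_one_eq_two] using hg)
    exact this.2.2
  have hg2 : ∀ x, HasDerivAt (deriv g) (deriv (deriv g) x) x := fun x =>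
    (hd.differentiable (by norm_num)).differentiableAt.hasDerivAt
  have hc2 : Continuous (deriv (deriv g)) := hd.continuous_deriv (by norm_num)
  have hper : ∀ {h : ℝ → ℂ}, Function.Periodic h T → Function.Periodic (deriv h) T := by
    intro h hh x
    rw [← deriv_comp_add_const]
    congr 1
    exact funext hh
  have hp1 := hper hp
  have hp2 := hper hp1
  obtain ⟨M, hM⟩ : ∃ M, ∀ x, ‖deriv (deriv g) x‖ ≤ M := by
    obtain ⟨M, hM⟩ := (isCompact_Icc (a := 0) (b := T)).exists_bound_of_continuousOn
      hc2.continuousOn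
    refine ⟨M, fun x => ?_⟩
    obtain ⟨y, hy, e⟩ := hp2.exists_mem_Ico₀ hT x
    rw [e]
    exact hM y ⟨hy.1, hy.2.le⟩
  have : Fact (0 < T) := ⟨hT⟩
  let G : C(AddCircle T, ℂ) := ⟨hp.lift, by
    rw [continuous_coinduced_dom]
    exact hg.continuous⟩
  have hG : ∀ x : ℝ, G (x : AddCircle T) = g x := fun x => rfl
  have hcoef : ∀ n, fourierCoeff G n = fourierCoeffOn hT g n := by
    intro n
    rw [fourierCoeff_eq_intervalIntegral _ _ 0, fourierCoeffOn_eq_integral]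
    simp only [fourier_coe_apply, hG, zero_add, sub_zero]
  have hbound : ∀ n : ℤ, n ≠ 0 → ‖fourierCoeff G n‖ ≤ (T / (2 * π)) ^ 2 * M * (1 / (n:ℝ) ^ 2) := by
    intro n hn
    rw [hcoef, fourierCoeffOn_eq_of_hasDerivAt_of_periodic hT hg1 hd.continuous hp hn,
      fourierCoeffOn_eq_of_hasDerivAt_of_periodic hT hg2 hc2 hp1 hn]
    have hn' : (0:ℝ) < |(n:ℝ)| := by simpa using hn
    simp only [norm_mul, norm_div, Complex.norm_real, Complex.norm_I, Complex.norm_intCast,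
      Real.norm_eq_abs, abs_of_pos hT, abs_of_pos pi_pos, Complex.norm_ofNat, mul_one]
    calc T / (2 * π * |(n:ℝ)|) * (T / (2 * π * |(n:ℝ)|) * ‖fourierCoeffOn hT (deriv (deriv g)) n‖)
        ≤ T / (2 * π * |(n:ℝ)|) * (T / (2 * π * |(n:ℝ)|) * M) := by
          gcongr
          exact norm_fourierCoeffOn_le hT hM n
      _ = _ := by rw [← sq_abs (n:ℝ)]; field_simp
  have hc0 : fourierCoeff G 0 = 0 := by
    rw [fourierCoeff_eq_intervalIntegral _ _ 0]
    simp [hG, hmean]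
  have hsum : Summable fun n : ℤ => ‖fourierCoeff G n‖ := by
    refine Summable.of_nonneg_of_le (fun _ => norm_nonneg _) (fun n => ?_)
      ((Real.summable_one_div_int_pow.2 one_lt_two).mul_left ((T / (2 * π)) ^ 2 * M))
    rcases eq_or_ne n 0 with rfl | hn
    · simp [hc0]
    · exact hbound n hn
  refine ⟨fourierCoeff G, hsum, hc0, fun x => ?_⟩
  have := has_pointwise_sum_fourier_series_of_summable hsum.of_norm (x : AddCircle T)
  simpa only [smul_eq_mul, fourier_coe_apply, hG] using this

theorem exists_hasSum_real_fourier {g : ℝ → ℝ} (hg : ContDiff ℝ 2 g)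
    (hp : ∀ θ, g (θ + π / 2) = g θ) (hmean : ∫ θ in (0:ℝ)..(π / 2), g θ = 0) :
    ∃ (N : ℤ → ℕ) (a : ℤ → ℝ) (e e' : ℤ → ℝ → ℝ), (∀ n, 4 ≤ N n) ∧ Summable a ∧
      (∀ n θ, HasDerivAt (e n) (e' n θ) θ) ∧
      (∀ n θ, HasDerivAt (e' n) (-(N n:ℝ) ^ 2 * e n θ) θ) ∧
      (∀ n θ, |e n θ| ≤ a n) ∧ (∀ n θ, |e' n θ| ≤ N n * a n) ∧
      (∀ n, Function.Periodic (e n) (2 * π)) ∧ (∀ n, Function.Periodic (e' n) (2 * π)) ∧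
      ∀ θ, HasSum (fun n => e n θ) (g θ) := by
  obtain ⟨c, hs, hc0, hc⟩ := exists_hasSum_fourier (T := π / 2) (by positivity)
    (g := fun x => (g x : ℂ)) (Complex.ofRealCLM.contDiff.comp hg)
    (fun x => by simp only [hp]) (by rw [intervalIntegral.integral_ofReal, hmean]; simp)
  set E : ℤ → ℝ → ℂ := fun n θ => c n * Complex.exp (4 * n * θ * Complex.I) with hE
  set E' : ℤ → ℝ → ℂ := fun n θ => 4 * n * Complex.I * E n θ with hE'
  have dE : ∀ n θ, HasDerivAt (E n) (E' n θ) θ := by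
    intro n θ
    have h1 : HasDerivAt (fun θ : ℝ => (4 * n * θ * Complex.I : ℂ)) (4 * n * Complex.I) θ := by
      have := ((Complex.ofRealCLM.hasDerivAt (x := θ)).const_mul (4 * n : ℂ)).mul_const Complex.I
      simpa using this
    convert! (h1.cexp).const_mul (c n) using 1
    simp only [hE', hE]; ring
  have nE : ∀ n θ, ‖E n θ‖ = ‖c n‖ := by
    intro n θ
    have : (4 * n * θ * Complex.I : ℂ) = ((4 * n * θ : ℝ) : ℂ) * Complex.I := by push_cast; ring
    simp only [hE]
    rw [norm_mul, this, Complex.norm_exp_ofReal_mul_I, mul_one]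
  have pE : ∀ n, Function.Periodic (E n) (2 * π) := by
    intro n θ
    simp only [hE]
    have : (4 * n * ((θ + 2 * π : ℝ) : ℂ) * Complex.I) =
        4 * n * θ * Complex.I + ((4 * n : ℤ) : ℂ) * (2 * π * Complex.I) := by push_cast; ring
    rw [this, Complex.exp_periodic.int_mul (4 * n) _]
  have hE0 : ∀ θ, E 0 θ = 0 := by intro θ; simp [hE, hc0]
  have hre : ∀ {F : ℝ → ℂ} {F' : ℂ} {x : ℝ}, HasDerivAt F F' x →
      HasDerivAt (fun y => (F y).re) F'.re x := fun h =>
    (Complex.reCLM.hasFDerivAt.comp_hasDerivAt _ h)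
  refine ⟨fun n => 4 * max 1 n.natAbs, fun n => ‖c n‖, fun n θ => (E n θ).re,
    fun n θ => (E' n θ).re, fun n => ?_, hs, fun n θ => hre (dE n θ), fun n θ => ?_,
    fun n θ => (Complex.abs_re_le_norm _).trans (nE n θ).le, fun n θ => ?_,
    fun n θ => by simp only [pE n θ], fun n θ => by simp only [hE', pE n θ], fun θ => ?_⟩
  · have := le_max_left 1 n.natAbs
    dsimp only
    omega
  · convert! hre ((dE n θ).const_mul (4 * n * Complex.I : ℂ)) using 1
    dsimp only
    rcases eq_or_ne n 0 with rfl | hn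
    · simp [hE0]
    · have h1 : max 1 n.natAbs = n.natAbs := max_eq_right (by omega)
      have : (4 * n * Complex.I : ℂ) * E' n θ = ((-(4 * n) ^ 2 : ℝ) : ℂ) * E n θ := by
        simp only [hE']; push_cast; linear_combination (16 * n ^ 2 * E n θ) * Complex.I_sq
      rw [this, Complex.re_ofReal_mul, h1]
      push_cast
      rw [Nat.cast_natAbs, Int.cast_abs, mul_pow, mul_pow, sq_abs]
  · refine (Complex.abs_re_le_norm _).trans ?_
    simp only [hE', norm_mul, nE, Complex.norm_I, mul_one, Complex.norm_ofNat,
      Complex.norm_intCast]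
    gcongr
    push_cast
    gcongr
    rw [Nat.cast_natAbs, Int.cast_abs]
    exact le_max_right _ _
  · convert! Complex.hasSum_re (hc θ) using 1
    funext n
    simp only [hE]
    congr 3
    have : (π : ℂ) ≠ 0 := by exact_mod_cast pi_ne_zero
    push_cast
    field_simp
    ring

/-- The linear form on the plane with partial derivatives `a` and `b`. -/
noncomputable def pairForm (a b : ℝ) : ℝ × ℝ →L[ℝ] ℝ :=
  a • ContinuousLinearMap.fst ℝ ℝ ℝ + b • ContinuousLinearMap.snd ℝ ℝ ℝ

@[simp] theorem pairForm_apply (a b : ℝ) (p : ℝ × ℝ) : pairForm a b p = a * p.1 + b * p.2 := by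
  simp [pairForm]

theorem norm_pairForm_le (a b : ℝ) : ‖pairForm a b‖ ≤ |a| + |b| := by
  refine ContinuousLinearMap.opNorm_le_bound _ (by positivity) fun p => ?_
  rw [pairForm_apply, add_mul]
  refine (norm_add_le _ _).trans ?_
  rw [norm_mul, norm_mul]
  exact add_le_add (mul_le_mul_of_nonneg_left (norm_fst_le p) (abs_nonneg _))
    (mul_le_mul_of_nonneg_left (norm_snd_le p) (abs_nonneg _))

theorem hasFDerivAt_tsum_pairForm {ι : Type*} {p p₁ p₂ : ι → ℝ × ℝ → ℝ} {b : ι → ℝ}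
    (hb : Summable b) (hd : ∀ n x, HasFDerivAt (p n) (pairForm (p₁ n x) (p₂ n x)) x)
    (h0 : ∀ n x, |p n x| ≤ b n) (h1 : ∀ n x, |p₁ n x| ≤ b n) (h2 : ∀ n x, |p₂ n x| ≤ b n)
    (x : ℝ × ℝ) :
    HasFDerivAt (fun y => ∑' n, p n y) (pairForm (∑' n, p₁ n x) (∑' n, p₂ n x)) x := by
  have h := hasFDerivAt_tsum (hb.add hb) hd
    (fun n x => (norm_pairForm_le _ _).trans (add_le_add (h1 n x) (h2 n x)))
    (x₀ := 0) (hb.of_norm_bounded fun n => h0 n 0) x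
  have s1 : Summable fun n => p₁ n x := hb.of_norm_bounded fun n => h1 n x
  have s2 : Summable fun n => p₂ n x := hb.of_norm_bounded fun n => h2 n x
  convert! h using 1
  simp only [pairForm]
  rw [(s1.smul_const _).tsum_add (s2.smul_const _), s1.tsum_smul_const, s2.tsum_smul_const]

theorem hasFDerivAt_mul_pairForm {U e : ℝ → ℝ} {u' e' : ℝ} {x : ℝ × ℝ}
    (hU : HasDerivAt U u' x.1) (he : HasDerivAt e e' x.2) :
    HasFDerivAt (fun y : ℝ × ℝ => U y.1 * e y.2) (pairForm (u' * e x.2) (U x.1 * e')) x := by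
  have h1 := hU.comp_hasFDerivAt x (hasFDerivAt_fst (𝕜 := ℝ) (p := x))
  have h2 := he.comp_hasFDerivAt x (hasFDerivAt_snd (𝕜 := ℝ) (p := x))
  convert! h1.mul h2 using 1
  ext <;> simp [pairForm, mul_comm]

theorem abs_tsum_le_of_abs_le {ι : Type*} {p a : ι → ℝ} {K : ℝ} (ha : Summable a)
    (h : ∀ n, ‖p n‖ ≤ K * a n) : |∑' n, p n| ≤ K * ∑' n, a n := by
  rw [← tsum_mul_left]
  exact tsum_of_norm_bounded (ha.mul_left K).hasSum h

/-- A `C²` function in log-polar coordinates `(t, θ)`, recorded with its partial derivatives up to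
order two, all of which are `O(exp (3 t))` and `2π`-periodic in `θ`. -/
structure LogPolarC2 (u ut uθ utt utθ uθθ : ℝ × ℝ → ℝ) (K : ℝ) : Prop where
  du : ∀ x, HasFDerivAt u (pairForm (ut x) (uθ x)) x
  dut : ∀ x, HasFDerivAt ut (pairForm (utt x) (utθ x)) x
  duθ : ∀ x, HasFDerivAt uθ (pairForm (utθ x) (uθθ x)) x
  ctt : Continuous utt
  ctθ : Continuous utθ
  cθθ : Continuous uθθ
  bu : ∀ x, |u x| ≤ K * exp x.1 ^ 3
  but : ∀ x, |ut x| ≤ K * exp x.1 ^ 3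
  buθ : ∀ x, |uθ x| ≤ K * exp x.1 ^ 3
  butt : ∀ x, |utt x| ≤ K * exp x.1 ^ 3
  butθ : ∀ x, |utθ x| ≤ K * exp x.1 ^ 3
  buθθ : ∀ x, |uθθ x| ≤ K * exp x.1 ^ 3
  pu : ∀ t θ, u (t, θ + 2 * π) = u (t, θ)
  put : ∀ t θ, ut (t, θ + 2 * π) = ut (t, θ)
  puθ : ∀ t θ, uθ (t, θ + 2 * π) = uθ (t, θ)

theorem exists_logPolar_solution {f g : ℝ → ℝ} {C : ℝ} (hC : 0 ≤ C) (hf : Continuous f)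
    (hf1 : ∀ ρ, 1 ≤ ρ → f ρ = 0) (hfC : ∀ ρ, 0 ≤ ρ → |f ρ| ≤ C * ρ)
    {N : ℤ → ℕ} {a : ℤ → ℝ} {e e' : ℤ → ℝ → ℝ} (hN : ∀ n, 4 ≤ N n) (ha : Summable a)
    (he : ∀ n θ, HasDerivAt (e n) (e' n θ) θ)
    (he' : ∀ n θ, HasDerivAt (e' n) (-(N n:ℝ) ^ 2 * e n θ) θ)
    (hea : ∀ n θ, |e n θ| ≤ a n) (hea' : ∀ n θ, |e' n θ| ≤ N n * a n)
    (hp : ∀ n, Function.Periodic (e n) (2 * π)) (hp' : ∀ n, Function.Periodic (e' n) (2 * π))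
    (hg : ∀ θ, HasSum (fun n => e n θ) (g θ)) :
    ∃ (u ut uθ utt utθ uθθ : ℝ × ℝ → ℝ) (K : ℝ), LogPolarC2 u ut uθ utt utθ uθθ K ∧
      ∀ x, utt x + uθθ x = exp x.1 ^ 2 * f (exp x.1) * g x.2 := by
  choose U U' dU dU' bU bU' gU gU' using fun n => exists_radial_solution hC hf hf1 hfC (N n) (hN n)
  set h : ℝ → ℝ := fun t => exp t ^ 2 * f (exp t) with hh
  have ch : Continuous h := by fun_prop
  have gh : ∀ t, |h t| ≤ C * exp t ^ 3 := by
    intro t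
    simp only [hh]
    rw [abs_mul, abs_of_pos (by positivity)]
    calc exp t ^ 2 * |f (exp t)| ≤ exp t ^ 2 * (C * exp t) := by
          gcongr; exact hfC _ (exp_pos t).le
      _ = _ := by ring
  have bh : ∀ t, |h t| ≤ C := by
    intro t
    rcases le_total 0 t with ht | ht
    · simp [hh, hf1 _ (one_le_exp ht), hC]
    · exact (gh t).trans (mul_le_of_le_one_right hC
        (pow_le_one₀ (exp_pos t).le (exp_le_one_iff.mpr ht)))
  have ha0 : ∀ n, 0 ≤ a n := fun n => (abs_nonneg _).trans (hea n 0)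
  have cU : ∀ n, Continuous (U n) := fun n =>
    continuous_iff_continuousAt.2 fun t => (dU n t).continuousAt
  have cU' : ∀ n, Continuous (U' n) := fun n =>
    continuous_iff_continuousAt.2 fun t => (dU' n t).continuousAt
  have ce : ∀ n, Continuous (e n) := fun n =>
    continuous_iff_continuousAt.2 fun t => (he n t).continuousAt
  have ce' : ∀ n, Continuous (e' n) := fun n =>
    continuous_iff_continuousAt.2 fun t => (he' n t).continuousAt
  have hN1 : ∀ n, (1:ℝ) ≤ N n := fun n => by
    have := hN n
    exact_mod_cast (by omega : 1 ≤ N n)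
  -- termwise bounds with a common majorant `X` of the radial quantities
  have key : ∀ (X : ℝ) (n : ℤ) (x : ℝ × ℝ), (N n:ℝ) ^ 2 * |U n x.1| ≤ 5 * X →
      (N n:ℝ) * |U' n x.1| ≤ 5 * X → |h x.1| ≤ X →
      |U n x.1 * e n x.2| ≤ 6 * X * a n ∧ |U' n x.1 * e n x.2| ≤ 6 * X * a n ∧
      |U n x.1 * e' n x.2| ≤ 6 * X * a n ∧
      |((N n:ℝ) ^ 2 * U n x.1 + h x.1) * e n x.2| ≤ 6 * X * a n ∧
      |U' n x.1 * e' n x.2| ≤ 6 * X * a n ∧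
      |U n x.1 * (-(N n:ℝ) ^ 2 * e n x.2)| ≤ 6 * X * a n := by
    intro X n x h1 h2 h3
    have hX : 0 ≤ X := (abs_nonneg _).trans h3
    have n1 := hN1 n
    have i1 : |U n x.1| ≤ (N n:ℝ) * |U n x.1| := le_mul_of_one_le_left (abs_nonneg _) n1
    have i2 : (N n:ℝ) * |U n x.1| ≤ (N n:ℝ) ^ 2 * |U n x.1| := by
      rw [sq, mul_assoc]; exact le_mul_of_one_le_left (by positivity) n1
    have i3 : |U' n x.1| ≤ (N n:ℝ) * |U' n x.1| := le_mul_of_one_le_left (abs_nonneg _) n1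
    have a0 := ha0 n
    refine ⟨?_, ?_, ?_, ?_, ?_, ?_⟩ <;> rw [abs_mul]
    · exact mul_le_mul (by linarith) (hea n _) (abs_nonneg _) (by positivity)
    · exact mul_le_mul (by linarith) (hea n _) (abs_nonneg _) (by positivity)
    · calc |U n x.1| * |e' n x.2| ≤ |U n x.1| * (N n * a n) := by gcongr; exact hea' n _
        _ = (N n * |U n x.1|) * a n := by ring
        _ ≤ _ := mul_le_mul_of_nonneg_right (by linarith) a0
    · refine mul_le_mul ((abs_add_le _ _).trans ?_) (hea n _) (abs_nonneg _) (by positivity)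
      rw [abs_mul, abs_of_nonneg (by positivity)]
      linarith
    · calc |U' n x.1| * |e' n x.2| ≤ |U' n x.1| * (N n * a n) := by gcongr; exact hea' n _
        _ = (N n * |U' n x.1|) * a n := by ring
        _ ≤ _ := mul_le_mul_of_nonneg_right (by linarith) a0
    · rw [abs_mul, abs_neg, abs_of_nonneg (by positivity : 0 ≤ (N n:ℝ) ^ 2)]
      calc |U n x.1| * ((N n:ℝ) ^ 2 * |e n x.2|) ≤ |U n x.1| * ((N n:ℝ) ^ 2 * a n) := by
            gcongr; exact hea n _
        _ = ((N n:ℝ) ^ 2 * |U n x.1|) * a n := by ring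
        _ ≤ _ := mul_le_mul_of_nonneg_right (by linarith) a0
  have kb := fun n x => key C n x (bU n x.1) (bU' n x.1) (bh x.1)
  have kg := fun x n => key (C * exp x.1 ^ 3) n x (by linarith [gU n x.1])
    (by linarith [gU' n x.1]) (gh x.1)
  have hb := ha.mul_left (6 * C)
  have bound : ∀ {p : ℤ → ℝ × ℝ → ℝ},
      (∀ x n, |p n x| ≤ 6 * (C * exp x.1 ^ 3) * a n) →
      ∀ x, |∑' n, p n x| ≤ (6 * C * ∑' n, a n) * exp x.1 ^ 3 := by
    intro p hp x
    refine (abs_tsum_le_of_abs_le ha (hp x)).trans (le_of_eq (by ring))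
  refine ⟨fun x => ∑' n, U n x.1 * e n x.2, fun x => ∑' n, U' n x.1 * e n x.2,
    fun x => ∑' n, U n x.1 * e' n x.2, fun x => ∑' n, ((N n:ℝ) ^ 2 * U n x.1 + h x.1) * e n x.2,
    fun x => ∑' n, U' n x.1 * e' n x.2, fun x => ∑' n, U n x.1 * (-(N n:ℝ) ^ 2 * e n x.2),
    6 * C * ∑' n, a n, ?_, ?_⟩
  · exact
    { du := hasFDerivAt_tsum_pairForm hb
        (fun n x => hasFDerivAt_mul_pairForm (dU n x.1) (he n x.2))
        (fun n x => (kb n x).1) (fun n x => (kb n x).2.1) (fun n x => (kb n x).2.2.1)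
      dut := hasFDerivAt_tsum_pairForm hb
        (fun n x => hasFDerivAt_mul_pairForm (dU' n x.1) (he n x.2))
        (fun n x => (kb n x).2.1) (fun n x => (kb n x).2.2.2.1) (fun n x => (kb n x).2.2.2.2.1)
      duθ := hasFDerivAt_tsum_pairForm hb
        (fun n x => hasFDerivAt_mul_pairForm (dU n x.1) (he' n x.2))
        (fun n x => (kb n x).2.2.1) (fun n x => (kb n x).2.2.2.2.1)
        (fun n x => (kb n x).2.2.2.2.2)
      ctt := continuous_tsum (fun n => by have := cU n; have := ce n; fun_prop) hb
        (fun n x => (kb n x).2.2.2.1)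
      ctθ := continuous_tsum (fun n => by have := cU' n; have := ce' n; fun_prop) hb
        (fun n x => (kb n x).2.2.2.2.1)
      cθθ := continuous_tsum (fun n => by have := cU n; have := ce n; fun_prop) hb
        (fun n x => (kb n x).2.2.2.2.2)
      bu := bound fun x n => (kg x n).1
      but := bound fun x n => (kg x n).2.1
      buθ := bound fun x n => (kg x n).2.2.1
      butt := bound fun x n => (kg x n).2.2.2.1
      butθ := bound fun x n => (kg x n).2.2.2.2.1
      buθθ := bound fun x n => (kg x n).2.2.2.2.2
      pu := fun t θ => by simp only [hp _ θ]
      put := fun t θ => by simp only [hp _ θ]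
      puθ := fun t θ => by simp only [hp' _ θ] }
  · intro x
    dsimp only
    have s1 : Summable fun n => ((N n:ℝ) ^ 2 * U n x.1 + h x.1) * e n x.2 :=
      hb.of_norm_bounded fun n => (kb n x).2.2.2.1
    have s2 : Summable fun n => U n x.1 * (-(N n:ℝ) ^ 2 * e n x.2) :=
      hb.of_norm_bounded fun n => (kb n x).2.2.2.2.2
    rw [← s1.tsum_add s2, ← (hg x.2).tsum_eq, ← tsum_mul_left]
    congr 1
    funext n
    simp only [hh]; ring

/-- Transport of a function of log-polar coordinates `(t, θ)` to the plane, with value `0` at the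
origin. -/
noncomputable def logPolarPull (v : ℝ × ℝ → ℝ) (p : ℝ × ℝ) : ℝ :=
  if p = 0 then 0 else v (Real.log (p.1 ^ 2 + p.2 ^ 2) / 2, Complex.arg ⟨p.1, p.2⟩)

/-- The derivative in the Cartesian direction of angle `β`, in log-polar coordinates, of a function
with partial derivatives `v₁` and `v₂`. -/
noncomputable def logPolarDir (β : ℝ) (v₁ v₂ : ℝ × ℝ → ℝ) (x : ℝ × ℝ) : ℝ :=
  exp (-x.1) * (cos (x.2 - β) * v₁ x - sin (x.2 - β) * v₂ x)

theorem logPolarPull_zero (v : ℝ × ℝ → ℝ) : logPolarPull v 0 = 0 := if_pos rfl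

theorem logPolarPull_of_ne {p : ℝ × ℝ} (hp : p ≠ 0) (v : ℝ × ℝ → ℝ) : logPolarPull v p =
    v (Real.log (p.1 ^ 2 + p.2 ^ 2) / 2, Complex.arg ⟨p.1, p.2⟩) := if_neg hp

theorem complex_mk_ne_zero {p : ℝ × ℝ} (hp : p ≠ 0) : (⟨p.1, p.2⟩ : ℂ) ≠ 0 := by
  intro h
  exact hp (Prod.ext (congrArg Complex.re h) (congrArg Complex.im h))

theorem sq_add_sq_pos_of_ne {p : ℝ × ℝ} (hp : p ≠ 0) : 0 < p.1 ^ 2 + p.2 ^ 2 := by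
  have h := Complex.normSq_pos.2 (complex_mk_ne_zero hp)
  rw [Complex.normSq_mk] at h
  nlinarith

theorem exp_log_div_two {p : ℝ × ℝ} (hp : p ≠ 0) :
    exp (Real.log (p.1 ^ 2 + p.2 ^ 2) / 2) = √(p.1 ^ 2 + p.2 ^ 2) := by
  rw [← Real.log_sqrt (sq_add_sq_pos_of_ne hp).le,
    Real.exp_log (Real.sqrt_pos.2 (sq_add_sq_pos_of_ne hp))]

theorem norm_complex_mk (p : ℝ × ℝ) : ‖(⟨p.1, p.2⟩ : ℂ)‖ = √(p.1 ^ 2 + p.2 ^ 2) := by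
  rw [Complex.norm_def, Complex.normSq_mk]; congr 1; ring

theorem sqrt_mul_cos_arg (p : ℝ × ℝ) :
    √(p.1 ^ 2 + p.2 ^ 2) * cos (Complex.arg ⟨p.1, p.2⟩) = p.1 := by
  rw [← norm_complex_mk, Complex.norm_mul_cos_arg]

theorem sqrt_mul_sin_arg (p : ℝ × ℝ) :
    √(p.1 ^ 2 + p.2 ^ 2) * sin (Complex.arg ⟨p.1, p.2⟩) = p.2 := by
  rw [← norm_complex_mk, Complex.norm_mul_sin_arg]

theorem hasFDerivAt_log_radius {p : ℝ × ℝ} (hp : p ≠ 0) :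
    HasFDerivAt (fun q : ℝ × ℝ => Real.log (q.1 ^ 2 + q.2 ^ 2) / 2)
      (pairForm (p.1 / (p.1 ^ 2 + p.2 ^ 2)) (p.2 / (p.1 ^ 2 + p.2 ^ 2))) p := by
  have h0 := sq_add_sq_pos_of_ne hp
  have h1 := (((hasFDerivAt_fst (𝕜 := ℝ) (p := p)).pow 2).add
    ((hasFDerivAt_snd (𝕜 := ℝ) (p := p)).pow 2)).log h0.ne'
  have h2 := h1.mul_const (2⁻¹ : ℝ)
  convert! h2 using 1
  ext <;> simp [pairForm] <;> field_simp

theorem exists_angle_lift {p : ℝ × ℝ} (hp : p ≠ 0) : ∃ φ : ℝ × ℝ → ℝ,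
    HasFDerivAt φ (pairForm (-p.2 / (p.1 ^ 2 + p.2 ^ 2)) (p.1 / (p.1 ^ 2 + p.2 ^ 2))) p ∧
    φ p = Complex.arg ⟨p.1, p.2⟩ ∧
    ∀ q : ℝ × ℝ, q ≠ 0 → ∃ k : ℤ, φ q = Complex.arg ⟨q.1, q.2⟩ + k * (2 * π) := by
  set α := Complex.arg ⟨p.1, p.2⟩ with hα
  set ω : ℂ := Complex.exp (-(α : ℂ) * Complex.I) with hω
  have hz := complex_mk_ne_zero hp
  have hω0 : ω ≠ 0 := Complex.exp_ne_zero _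
  have hrot : (⟨p.1, p.2⟩ : ℂ) * ω = (‖(⟨p.1, p.2⟩ : ℂ)‖ : ℂ) := by
    have h := Complex.norm_mul_exp_arg_mul_I (⟨p.1, p.2⟩ : ℂ)
    rw [← hα] at h
    calc (⟨p.1, p.2⟩ : ℂ) * ω
        = (‖(⟨p.1, p.2⟩ : ℂ)‖ : ℂ) * (Complex.exp (α * Complex.I) * ω) := by
          rw [← mul_assoc, h]
      _ = _ := by rw [hω, ← Complex.exp_add]; simp
  have hslit : (⟨p.1, p.2⟩ : ℂ) * ω ∈ Complex.slitPlane := by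
    rw [hrot, Complex.ofReal_mem_slitPlane]
    exact norm_pos_iff.2 hz
  refine ⟨fun q => Complex.arg ((⟨q.1, q.2⟩ : ℂ) * ω) + α, ?_, ?_, fun q hq => ?_⟩
  · have e : HasFDerivAt (fun q : ℝ × ℝ => (⟨q.1, q.2⟩ : ℂ))
        (Complex.equivRealProdCLM.symm : ℝ × ℝ →L[ℝ] ℂ) p :=
      (Complex.equivRealProdCLM.symm : ℝ × ℝ →L[ℝ] ℂ).hasFDerivAt
    have h1 : HasDerivAt (fun z : ℂ => Complex.log (z * ω)) (((⟨p.1, p.2⟩ : ℂ))⁻¹)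
        (⟨p.1, p.2⟩ : ℂ) := by
      have := ((hasDerivAt_id (⟨p.1, p.2⟩ : ℂ)).mul_const ω).clog hslit
      convert! this using 1
      simp only [id]
      field_simp
    have h2 := (h1.complexToReal_fderiv.comp p e)
    have h3 := (Complex.imCLM.hasFDerivAt.comp p h2).add_const α
    have h4 : (fun q : ℝ × ℝ => Complex.arg ((⟨q.1, q.2⟩ : ℂ) * ω) + α) =
        fun q => (Complex.imCLM ∘ (fun z : ℂ => Complex.log (z * ω)) ∘
          fun q : ℝ × ℝ => (⟨q.1, q.2⟩ : ℂ)) q + α := by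
      funext q; simp [Complex.log_im]
    rw [h4]
    convert! h3 using 1
    ext <;> simp [pairForm, Complex.normSq_mk, sq]
  · simp only [hrot]
    rw [Complex.arg_ofReal_of_nonneg (norm_nonneg _), zero_add]
  · have h : ((Complex.arg ((⟨q.1, q.2⟩ : ℂ) * ω) + α : ℝ) : Real.Angle) =
        (Complex.arg ⟨q.1, q.2⟩ : ℝ) := by
      have h2 : ((⟨p.1, p.2⟩ : ℂ) * ω).arg = 0 := by
        rw [hrot, Complex.arg_ofReal_of_nonneg (norm_nonneg _)]
      have h3 := Complex.arg_mul_coe_angle hz hω0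
      rw [h2, ← hα] at h3
      rw [Real.Angle.coe_add, Complex.arg_mul_coe_angle (complex_mk_ne_zero hq) hω0, add_assoc,
        add_comm (ω.arg : Real.Angle), ← h3]
      simp
    obtain ⟨k, hk⟩ := Real.Angle.angle_eq_iff_two_pi_dvd_sub.1 h
    exact ⟨k, by linarith⟩

theorem logPolarPull_eq_of_angle {v : ℝ × ℝ → ℝ} (hv : ∀ t θ, v (t, θ + 2 * π) = v (t, θ))
    {p : ℝ × ℝ} (hp : p ≠ 0) {θ : ℝ} (hθ : ∃ k : ℤ, θ = Complex.arg ⟨p.1, p.2⟩ + k * (2 * π)) :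
    logPolarPull v p = v (Real.log (p.1 ^ 2 + p.2 ^ 2) / 2, θ) := by
  obtain ⟨k, rfl⟩ := hθ
  have h : Function.Periodic (fun θ => v (Real.log (p.1 ^ 2 + p.2 ^ 2) / 2, θ)) (2 * π) :=
    fun θ => hv _ θ
  rw [logPolarPull_of_ne hp]
  exact (h.int_mul k _).symm

theorem continuous_logPolarPull {v : ℝ × ℝ → ℝ} {K : ℝ} (hc : Continuous v)
    (hv : ∀ t θ, v (t, θ + 2 * π) = v (t, θ)) (hb : ∀ x, |v x| ≤ K * exp x.1) :
    Continuous (logPolarPull v) := by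
  rw [continuous_iff_continuousAt]
  intro p
  rcases eq_or_ne p 0 with rfl | hp
  · rw [ContinuousAt, logPolarPull_zero]
    have h1 : Continuous fun p : ℝ × ℝ => K * √(p.1 ^ 2 + p.2 ^ 2) := by fun_prop
    have h2 := h1.tendsto 0
    simp only [Prod.fst_zero, Prod.snd_zero] at h2
    norm_num at h2
    refine squeeze_zero_norm (fun q => ?_) h2
    rcases eq_or_ne q 0 with rfl | hq
    · simp [logPolarPull_zero]
    · rw [logPolarPull_of_ne hq, ← exp_log_div_two hq]
      exact hb _
  · obtain ⟨φ, h1, -, h3⟩ := exists_angle_lift hp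
    have h4 : ContinuousAt (fun q : ℝ × ℝ => v (Real.log (q.1 ^ 2 + q.2 ^ 2) / 2, φ q)) p :=
      hc.continuousAt.comp ((hasFDerivAt_log_radius hp).continuousAt.prodMk h1.continuousAt)
    refine h4.congr ?_
    filter_upwards [isOpen_ne.mem_nhds hp] with q hq
    exact (logPolarPull_eq_of_angle hv hq (h3 q hq)).symm

theorem hasFDerivAt_logPolarPull {v v₁ v₂ : ℝ × ℝ → ℝ} {K : ℝ}
    (hd : ∀ x, HasFDerivAt v (pairForm (v₁ x) (v₂ x)) x)
    (hv : ∀ t θ, v (t, θ + 2 * π) = v (t, θ)) (hb : ∀ x, x.1 ≤ 0 → |v x| ≤ K * exp x.1 ^ 2)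
    (p : ℝ × ℝ) :
    HasFDerivAt (logPolarPull v) (pairForm (logPolarPull (logPolarDir 0 v₁ v₂) p)
      (logPolarPull (logPolarDir (π / 2) v₁ v₂) p)) p := by
  rcases eq_or_ne p 0 with rfl | hp
  · have h0 : pairForm 0 0 = 0 := by simp [pairForm]
    rw [logPolarPull_zero, logPolarPull_zero, h0]
    refine Asymptotics.IsBigO.hasFDerivAt (n := 2) ?_ one_lt_two
    refine Asymptotics.IsBigO.of_bound (2 * |K|) ?_
    have hsmall : ∀ᶠ q : ℝ × ℝ in nhds 0, q.1 ^ 2 + q.2 ^ 2 < 1 := by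
      have : Continuous fun q : ℝ × ℝ => q.1 ^ 2 + q.2 ^ 2 := by fun_prop
      exact this.tendsto 0 (gt_mem_nhds (by simp))
    filter_upwards [hsmall] with q hq1
    rcases eq_or_ne q 0 with rfl | hq
    · simp [logPolarPull_zero]
    · have h1 := hb (Real.log (q.1 ^ 2 + q.2 ^ 2) / 2, Complex.arg ⟨q.1, q.2⟩)
        (by have := Real.log_nonpos (sq_add_sq_pos_of_ne hq).le hq1.le; dsimp only; linarith)
      rw [← logPolarPull_of_ne hq v, exp_log_div_two hq, Real.sq_sqrt (sq_add_sq_pos_of_ne hq).le]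
        at h1
      have h2 : q.1 ^ 2 ≤ ‖q‖ ^ 2 := sq_le_sq' (by
        have := norm_fst_le q; rw [Real.norm_eq_abs] at this; linarith [(abs_le.1 this).1])
        ((le_abs_self _).trans (norm_fst_le q))
      have h3 : q.2 ^ 2 ≤ ‖q‖ ^ 2 := sq_le_sq' (by
        have := norm_snd_le q; rw [Real.norm_eq_abs] at this; linarith [(abs_le.1 this).1])
        ((le_abs_self _).trans (norm_snd_le q))
      rw [sub_zero, norm_pow, norm_norm, Real.norm_eq_abs]
      have h4 : q.1 ^ 2 + q.2 ^ 2 ≤ 2 * ‖q‖ ^ 2 := by linarith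
      calc |logPolarPull v q| ≤ K * (q.1 ^ 2 + q.2 ^ 2) := h1
        _ ≤ |K| * (q.1 ^ 2 + q.2 ^ 2) := by gcongr; exact le_abs_self K
        _ ≤ |K| * (2 * ‖q‖ ^ 2) := by gcongr
        _ = _ := by ring
  · obtain ⟨φ, h1, h2, h3⟩ := exists_angle_lift hp
    have h4 := (hd (Real.log (p.1 ^ 2 + p.2 ^ 2) / 2, φ p)).comp p
      ((hasFDerivAt_log_radius hp).prodMk h1)
    have h5 : logPolarPull v =ᶠ[nhds p]
        v ∘ fun q : ℝ × ℝ => (Real.log (q.1 ^ 2 + q.2 ^ 2) / 2, φ q) := by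
      filter_upwards [isOpen_ne.mem_nhds hp] with q hq
      exact logPolarPull_eq_of_angle hv hq (h3 q hq)
    convert! h4.congr_of_eventuallyEq h5 using 1
    rw [logPolarPull_of_ne hp, logPolarPull_of_ne hp, h2]
    simp only [logPolarDir, exp_neg, exp_log_div_two hp, sub_zero, cos_sub_pi_div_two,
      sin_sub_pi_div_two]
    have hr := Real.sqrt_pos.2 (sq_add_sq_pos_of_ne hp)
    have hs := Real.sq_sqrt (sq_add_sq_pos_of_ne hp).le
    have hx := sqrt_mul_cos_arg p
    have hy := sqrt_mul_sin_arg p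
    set r := √(p.1 ^ 2 + p.2 ^ 2)
    set α := Complex.arg ⟨p.1, p.2⟩
    set T := Real.log (p.1 ^ 2 + p.2 ^ 2) / 2
    clear_value r α T
    rw [← hs, ← hx, ← hy]
    ext
    · simp [pairForm]; field_simp; ring
    · simp [pairForm]; field_simp

theorem abs_cos_mul_sub_sin_mul_le (φ : ℝ) {a b X : ℝ} (ha : |a| ≤ X) (hb : |b| ≤ X) :
    |cos φ * a - sin φ * b| ≤ 2 * X := by
  refine (abs_sub _ _).trans ?_
  rw [abs_mul, abs_mul]
  have h1 := mul_le_of_le_one_left (abs_nonneg a) (abs_cos_le_one φ)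
  have h2 := mul_le_of_le_one_left (abs_nonneg b) (abs_sin_le_one φ)
  linarith

theorem abs_logPolarDir_le {β K : ℝ} {v₁ v₂ : ℝ × ℝ → ℝ} (m : ℕ) {x : ℝ × ℝ}
    (h1 : |v₁ x| ≤ K * exp x.1 ^ (m + 1)) (h2 : |v₂ x| ≤ K * exp x.1 ^ (m + 1)) :
    |logPolarDir β v₁ v₂ x| ≤ 2 * K * exp x.1 ^ m := by
  rw [logPolarDir, abs_mul, abs_of_pos (exp_pos _)]
  have h := abs_cos_mul_sub_sin_mul_le (x.2 - β) h1 h2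
  calc exp (-x.1) * |cos (x.2 - β) * v₁ x - sin (x.2 - β) * v₂ x|
      ≤ exp (-x.1) * (2 * (K * exp x.1 ^ (m + 1))) := by gcongr
    _ = 2 * K * exp x.1 ^ m := by
      rw [exp_neg]
      have := exp_pos x.1
      field_simp
      ring

theorem logPolarDir_periodic {β : ℝ} {v₁ v₂ : ℝ × ℝ → ℝ}
    (h1 : ∀ t θ, v₁ (t, θ + 2 * π) = v₁ (t, θ)) (h2 : ∀ t θ, v₂ (t, θ + 2 * π) = v₂ (t, θ))
    (t θ : ℝ) : logPolarDir β v₁ v₂ (t, θ + 2 * π) = logPolarDir β v₁ v₂ (t, θ) := by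
  have e : θ + 2 * π - β = θ - β + 2 * π := by ring
  simp only [logPolarDir, h1, h2, e, cos_add_two_pi, sin_add_two_pi]

theorem continuous_logPolarDir {β : ℝ} {v₁ v₂ : ℝ × ℝ → ℝ} (h1 : Continuous v₁)
    (h2 : Continuous v₂) : Continuous (logPolarDir β v₁ v₂) := by
  unfold logPolarDir; fun_prop

/-- The `t`-derivative of `logPolarDir β ut uθ`. -/
noncomputable def logPolarDirT (β : ℝ) (ut uθ utt utθ : ℝ × ℝ → ℝ) (x : ℝ × ℝ) : ℝ :=
  logPolarDir β utt utθ x - logPolarDir β ut uθ x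

/-- The `θ`-derivative of `logPolarDir β ut uθ`. -/
noncomputable def logPolarDirθ (β : ℝ) (ut uθ utθ uθθ : ℝ × ℝ → ℝ) (x : ℝ × ℝ) : ℝ :=
  logPolarDir β utθ uθθ x - exp (-x.1) * (cos (x.2 - β) * uθ x - sin (x.2 - β) * -ut x)

theorem hasFDerivAt_logPolarDir {β : ℝ} {ut uθ utt utθ uθθ : ℝ × ℝ → ℝ} {x : ℝ × ℝ}
    (h1 : HasFDerivAt ut (pairForm (utt x) (utθ x)) x)
    (h2 : HasFDerivAt uθ (pairForm (utθ x) (uθθ x)) x) :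
    HasFDerivAt (logPolarDir β ut uθ)
      (pairForm (logPolarDirT β ut uθ utt utθ x) (logPolarDirθ β ut uθ utθ uθθ x)) x := by
  have e := (hasFDerivAt_fst (𝕜 := ℝ) (p := x)).neg.exp
  have c := ((hasFDerivAt_snd (𝕜 := ℝ) (p := x)).sub_const β).cos
  have s := ((hasFDerivAt_snd (𝕜 := ℝ) (p := x)).sub_const β).sin
  have h := e.mul ((c.mul h1).sub (s.mul h2))
  convert! h using 1
  ext
  · simp [pairForm, logPolarDirT, logPolarDir]; ring
  · simp [pairForm, logPolarDirθ, logPolarDir]; ring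

theorem logPolarDir_second_sum (ut uθ utt utθ uθθ : ℝ × ℝ → ℝ) (x : ℝ × ℝ) :
    logPolarDir 0 (logPolarDirT 0 ut uθ utt utθ) (logPolarDirθ 0 ut uθ utθ uθθ) x +
      logPolarDir (π / 2) (logPolarDirT (π / 2) ut uθ utt utθ)
        (logPolarDirθ (π / 2) ut uθ utθ uθθ) x = exp (-x.1) ^ 2 * (utt x + uθθ x) := by
  simp only [logPolarDir, logPolarDirT, logPolarDirθ, sub_zero, cos_sub_pi_div_two,
    sin_sub_pi_div_two]
  linear_combination (exp (-x.1) ^ 2 * (utt x + uθθ x)) * sin_sq_add_cos_sq x.2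

theorem contDiff_succ_of_hasFDerivAt_pairForm {V W₁ W₂ : ℝ × ℝ → ℝ} {n : ℕ}
    (h : ∀ p, HasFDerivAt V (pairForm (W₁ p) (W₂ p)) p) (h1 : ContDiff ℝ n W₁)
    (h2 : ContDiff ℝ n W₂) : ContDiff ℝ (n + 1) V :=
  contDiff_succ_iff_hasFDerivAt.2 ⟨fun p => pairForm (W₁ p) (W₂ p), by
    unfold pairForm
    exact (h1.smul contDiff_const).add (h2.smul contDiff_const), h⟩

theorem hasDerivAt_fst_of_pairForm {V : ℝ × ℝ → ℝ} {a b x y : ℝ}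
    (h : HasFDerivAt V (pairForm a b) (x, y)) : HasDerivAt (fun s => V (s, y)) a x := by
  simpa [Function.comp_def] using h.comp_hasDerivAt x ((hasDerivAt_id x).prodMk (hasDerivAt_const x y))

theorem hasDerivAt_snd_of_pairForm {V : ℝ × ℝ → ℝ} {a b x y : ℝ}
    (h : HasFDerivAt V (pairForm a b) (x, y)) : HasDerivAt (fun s => V (x, s)) b y := by
  simpa [Function.comp_def] using h.comp_hasDerivAt y ((hasDerivAt_const y x).prodMk (hasDerivAt_id y))

theorem LogPolarC2.exists_planar {u ut uθ utt utθ uθθ : ℝ × ℝ → ℝ} {K : ℝ}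
    (h : LogPolarC2 u ut uθ utt utθ uθθ K) : ∃ V : ℝ × ℝ → ℝ, ContDiff ℝ 2 V ∧
      ∀ x y, (x, y) ≠ (0 : ℝ × ℝ) →
        deriv (fun s => deriv (fun s' => V (s', y)) s) x +
          deriv (deriv fun s => V (x, s)) y =
        exp (-(Real.log (x ^ 2 + y ^ 2) / 2)) ^ 2 *
          (utt (Real.log (x ^ 2 + y ^ 2) / 2, Complex.arg ⟨x, y⟩) +
            uθθ (Real.log (x ^ 2 + y ^ 2) / 2, Complex.arg ⟨x, y⟩)) := by
  have hK : 0 ≤ K := by simpa using (abs_nonneg _).trans (h.bu 0)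
  have cut : Continuous ut := continuous_iff_continuousAt.2 fun x => (h.dut x).continuousAt
  have cuθ : Continuous uθ := continuous_iff_continuousAt.2 fun x => (h.duθ x).continuousAt
  have per : ∀ {v v₁ v₂ : ℝ × ℝ → ℝ}, (∀ x, HasFDerivAt v (pairForm (v₁ x) (v₂ x)) x) →
      (∀ t θ, v (t, θ + 2 * π) = v (t, θ)) →
      (∀ t θ, v₁ (t, θ + 2 * π) = v₁ (t, θ)) ∧ ∀ t θ, v₂ (t, θ + 2 * π) = v₂ (t, θ) := by
    intro v v₁ v₂ hd hv
    have hshift : ∀ t θ, HasFDerivAt v (pairForm (v₁ (t, θ + 2 * π)) (v₂ (t, θ + 2 * π)))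
        (t, θ) := by
      intro t θ
      have h1 := (hd ((t, θ) + (0, 2 * π))).comp (t, θ)
        ((hasFDerivAt_id (𝕜 := ℝ) (t, θ)).add_const (0, 2 * π))
      have h2 : v = v ∘ fun x : ℝ × ℝ => id x + (0, 2 * π) := by
        funext ⟨t, θ⟩; simp [hv]
      rw [h2]
      simpa using h1
    have huniq := fun t θ => (hshift t θ).unique (hd (t, θ))
    constructor <;> intro t θ
    · simpa using congrArg (fun l => l ((1 : ℝ), (0 : ℝ))) (huniq t θ)
    · simpa using congrArg (fun l => l ((0 : ℝ), (1 : ℝ))) (huniq t θ)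
  have dw : ∀ β x, HasFDerivAt (logPolarDir β ut uθ)
      (pairForm (logPolarDirT β ut uθ utt utθ x) (logPolarDirθ β ut uθ utθ uθθ x)) x :=
    fun β x => hasFDerivAt_logPolarDir (h.dut x) (h.duθ x)
  have pw := fun β => logPolarDir_periodic (β := β) h.put h.puθ
  have pwd := fun β => per (dw β) (pw β)
  have bw : ∀ β x, |logPolarDir β ut uθ x| ≤ 2 * K * exp x.1 ^ 2 :=
    fun β x => abs_logPolarDir_le 2 (h.but x) (h.buθ x)
  have bwt : ∀ β x, |logPolarDirT β ut uθ utt utθ x| ≤ 4 * K * exp x.1 ^ 2 := by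
    intro β x
    refine (abs_sub _ _).trans ?_
    linarith [bw β x, abs_logPolarDir_le (β := β) 2 (h.butt x) (h.butθ x)]
  have bwθ : ∀ β x, |logPolarDirθ β ut uθ utθ uθθ x| ≤ 4 * K * exp x.1 ^ 2 := by
    intro β x
    refine (abs_sub _ _).trans ?_
    have := abs_logPolarDir_le (β := β) (v₁ := uθ) (v₂ := fun x => -ut x) 2 (h.buθ x)
      (by rw [abs_neg]; exact h.but x)
    rw [logPolarDir] at this
    linarith [abs_logPolarDir_le (β := β) 2 (h.butθ x) (h.buθθ x)]
  have dV := hasFDerivAt_logPolarPull h.du h.pu (K := K) (by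
    intro x hx
    refine (h.bu x).trans (mul_le_mul_of_nonneg_left ?_ hK)
    exact pow_le_pow_of_le_one (exp_pos _).le (exp_le_one_iff.2 hx) (by norm_num))
  have dW := fun β => hasFDerivAt_logPolarPull (dw β) (pw β) fun x _ => bw β x
  have cW : ∀ γ β, Continuous (logPolarPull (logPolarDir γ (logPolarDirT β ut uθ utt utθ)
      (logPolarDirθ β ut uθ utθ uθθ))) := by
    intro γ β
    refine continuous_logPolarPull (K := 2 * (4 * K)) (continuous_logPolarDir ?_ ?_)
      (logPolarDir_periodic (pwd β).1 (pwd β).2) fun x => ?_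
    · exact (continuous_logPolarDir h.ctt h.ctθ).sub (continuous_logPolarDir cut cuθ)
    · refine (continuous_logPolarDir h.ctθ h.cθθ).sub ?_
      fun_prop
    · simpa using abs_logPolarDir_le (β := γ) 1 (bwt β x) (bwθ β x)
  have c1 : ∀ β, ContDiff ℝ 1 (logPolarPull (logPolarDir β ut uθ)) := by
    intro β
    have := contDiff_succ_of_hasFDerivAt_pairForm (n := 0) (dW β)
      (by exact_mod_cast contDiff_zero.2 (cW 0 β))
      (by exact_mod_cast contDiff_zero.2 (cW (π / 2) β))
    simpa using this
  refine ⟨logPolarPull u, ?_, fun x y hxy => ?_⟩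
  · have := contDiff_succ_of_hasFDerivAt_pairForm (n := 1) dV (by simpa using c1 0)
      (by simpa using c1 _)
    simpa [one_add_one_eq_two] using this
  · have e1 : (fun s => deriv (fun s' => logPolarPull u (s', y)) s) =
        fun s => logPolarPull (logPolarDir 0 ut uθ) (s, y) :=
      funext fun s => (hasDerivAt_fst_of_pairForm (dV (s, y))).deriv
    have e2 : (deriv fun s => logPolarPull u (x, s)) =
        fun s => logPolarPull (logPolarDir (π / 2) ut uθ) (x, s) :=
      funext fun s => (hasDerivAt_snd_of_pairForm (dV (x, s))).deriv
    rw [e1, e2, (hasDerivAt_fst_of_pairForm (dW 0 (x, y))).deriv,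
      (hasDerivAt_snd_of_pairForm (dW (π / 2) (x, y))).deriv, logPolarPull_of_ne hxy,
      logPolarPull_of_ne hxy, logPolarDir_second_sum]

theorem exists_continuous_extension_of_abs_le {f fbar : ℝ → ℝ}
    (hs : ContDiffOn ℝ (⊤ : ℕ∞) fbar (Set.Icc 0 1)) (h0 : fbar 0 = 0) (h1 : fbar 1 = 0)
    (hf : ContinuousOn f (Set.Icc 0 1)) (hle : ∀ r ∈ Set.Icc (0:ℝ) 1, |f r| ≤ fbar r) :
    ∃ (F : ℝ → ℝ) (C : ℝ), 0 ≤ C ∧ Continuous F ∧ (∀ ρ, 1 ≤ ρ → F ρ = 0) ∧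
      (∀ ρ, 0 ≤ ρ → |F ρ| ≤ C * ρ) ∧ ∀ r ∈ Set.Icc (0:ℝ) 1, F r = f r := by
  obtain ⟨C, hC⟩ := hs.exists_lipschitzOnWith (by simp) (convex_Icc 0 1) isCompact_Icc
  have hf1 : f 1 = 0 := by
    have := hle 1 (by simp)
    rw [h1] at this
    simpa using this
  have hF1 : ∀ ρ : ℝ, 1 ≤ ρ → Set.IccExtend zero_le_one ((Set.Icc (0:ℝ) 1).domRestrict f) ρ = 0 := by
    intro ρ hρ
    rw [Set.IccExtend_of_right_le _ _ hρ]
    exact hf1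
  have hFf : ∀ r ∈ Set.Icc (0:ℝ) 1,
      Set.IccExtend zero_le_one ((Set.Icc (0:ℝ) 1).domRestrict f) r = f r := by
    intro r hr
    rw [Set.IccExtend_of_mem _ _ hr]
    rfl
  refine ⟨Set.IccExtend zero_le_one ((Set.Icc (0:ℝ) 1).domRestrict f), C, C.2,
    (continuousOn_iff_continuous_domRestrict.1 hf).Icc_extend', hF1, fun ρ hρ => ?_, hFf⟩
  rcases le_total 1 ρ with h | h
  · rw [hF1 ρ h, abs_zero]
    exact mul_nonneg C.2 hρ
  · rw [hFf ρ ⟨hρ, h⟩]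
    have h2 := hC.dist_le_mul ρ ⟨hρ, h⟩ 0 (by simp)
    rw [h0, Real.dist_eq, Real.dist_eq, sub_zero, sub_zero, abs_of_nonneg hρ] at h2
    exact (hle ρ ⟨hρ, h⟩).trans ((le_abs_self _).trans h2)

theorem stmt0
    (fbar : ℝ → ℝ)
    (hfbar_smooth : ContDiffOn ℝ (⊤ : ℕ∞) fbar (Set.Icc 0 1))
    (hfbar_nonneg : ∀ r ∈ Set.Icc (0:ℝ) 1, 0 ≤ fbar r)
    (hfbar_concave : ConcaveOn ℝ (Set.Icc 0 1) fbar)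
    (hfbar0 : fbar 0 = 0) (hfbar1 : fbar 1 = 0)
    (hfbar_lim : Filter.Tendsto (fun r => r * deriv fbar r)
      (nhdsWithin 0 (Set.Ioi 0)) (nhds 0))
    (g : ℝ → ℝ) (hg_smooth : ContDiff ℝ (⊤ : ℕ∞) g)
    (hg_per : ∀ θ : ℝ, g (θ + π / 2) = g θ)
    (hg_mean : ∫ θ in (0:ℝ)..(π/2), g θ = 0)
    (f : ℝ → ℝ) (hf_cont : ContinuousOn f (Set.Icc 0 1))
    (hf_le : ∀ r ∈ Set.Icc (0:ℝ) 1, |f r| ≤ fbar r) :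
    ∃ ψ : ℝ → ℝ → ℝ,
      ContDiffOn ℝ 2 (fun p : ℝ × ℝ => ψ p.1 p.2) {p : ℝ × ℝ | p.1 ^ 2 + p.2 ^ 2 ≤ 1} ∧
      ∀ x₁ x₂ : ℝ, 0 < Real.sqrt (x₁ ^ 2 + x₂ ^ 2) → Real.sqrt (x₁ ^ 2 + x₂ ^ 2) ≤ 1 →
        ∀ θ : ℝ, x₁ = Real.sqrt (x₁ ^ 2 + x₂ ^ 2) * Real.cos θ →
          x₂ = Real.sqrt (x₁ ^ 2 + x₂ ^ 2) * Real.sin θ →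
          deriv (fun s => deriv (fun s' => ψ s' x₂) s) x₁
            + deriv (deriv (ψ x₁)) x₂
            = f (Real.sqrt (x₁ ^ 2 + x₂ ^ 2)) * g θ := by
  obtain ⟨F, C, hC, cF, hF1, hFC, hFf⟩ :=
    exists_continuous_extension_of_abs_le hfbar_smooth hfbar0 hfbar1 hf_cont hf_le
  obtain ⟨N, a, e, e', hN, ha, he, he', hea, hea', hp, hp', hg⟩ :=
    exists_hasSum_real_fourier (contDiff_infty.1 hg_smooth 2) hg_per hg_mean
  obtain ⟨u, ut, uθ, utt, utθ, uθθ, K, hu, hlap⟩ :=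
    exists_logPolar_solution hC cF hF1 hFC hN ha he he' hea hea' hp hp' hg
  obtain ⟨V, hV, hΔ⟩ := hu.exists_planar
  refine ⟨fun x y => V (x, y), hV.contDiffOn, fun x y hpos hle θ hx hy => ?_⟩
  have hne : (x, y) ≠ (0 : ℝ × ℝ) := by
    intro h
    obtain ⟨rfl, rfl⟩ := Prod.mk_eq_zero.1 h
    simp at hpos
  refine (hΔ x y hne).trans ?_
  have hexp : exp (Real.log (x ^ 2 + y ^ 2) / 2) = √(x ^ 2 + y ^ 2) := exp_log_div_two hne
  rw [hlap, exp_neg]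
  dsimp only
  rw [hexp, hFf _ ⟨hpos.le, hle⟩]
  have hcos : cos (Complex.arg ⟨x, y⟩) = cos θ :=
    mul_left_cancel₀ hpos.ne' ((sqrt_mul_cos_arg (x, y)).trans hx)
  have hsin : sin (Complex.arg ⟨x, y⟩) = sin θ :=
    mul_left_cancel₀ hpos.ne' ((sqrt_mul_sin_arg (x, y)).trans hy)
  obtain ⟨k, hk⟩ := Real.Angle.angle_eq_iff_two_pi_dvd_sub.1 (Real.Angle.cos_sin_inj hcos hsin)
  have hgper : Function.Periodic g (π / 2) := hg_per
  have hgθ : g (Complex.arg ⟨x, y⟩) = g θ := by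
    have : Complex.arg ⟨x, y⟩ = θ + ((4 * k : ℤ) : ℝ) * (π / 2) := by push_cast; linarith
    rw [this]
    exact hgper.int_mul (4 * k) θ
  rw [hgθ]
  field_simp
end

section
/- Let $\bar f:[0,1]\to[0,\infty)$ be a smooth concave function with $\bar f(0)=\bar f(1)=0$ and $r\bar f'(r)\to 0$ as $r\to 0^+$, let $g:\mathbb R\to\mathbb R$ be a smooth $\tfrac{\pi}{2}$-periodic function with $\int_0^{\pi/2} g(\theta)\,d\theta=0$, and let $f:[0,1]\to\mathbb R$ be continuous with $|f|\le\bar f$ on $[0,1]$. Then there exist a constant $C>0$ (depending only on $g$) and a function $\psi:\mathbb R^2\to\mathbb R$, twice continuously differentiable on the closed unit ball, such that $\partial_{x_1}^2\psi+\partial_{x_2}^2\psi = f(|x|)g(\theta(x))$ for $0<|x|\le1$, and moreover for all $x$ with $|x|\le 1$ and all $i,j\in\{1,2\}$: $|\psi(x)|\le C|x|^2 M(|x|)$, $|\partial_{x_i}\psi(x)|\le C|x| M(|x|)$, and $|\partial_{x_i}\partial_{x_j}\psi(x)|\le C M(|x|)$, where $M(r)=\sup_{\tau\in[0,r]}\bar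 f(\tau)+\sup_{\tau\in[0,r]}\tau\bar f'(\tau)$. -/
open Real MeasureTheory Set

/-- The real-linear map `v ↦ p v + q v̄`, the differential of a function on `ℂ` whose Wirtinger
derivatives are `p` and `q`. -/
noncomputable def wirtinger (p q : ℂ) : ℂ →L[ℝ] ℂ :=
  p • ContinuousLinearMap.id ℝ ℂ + q • (Complex.conjCLE : ℂ →L[ℝ] ℂ)

lemma wirtinger_apply (p q v : ℂ) : wirtinger p q v = p * v + q * (starRingEnd ℂ) v := by
  simp [wirtinger]

lemma norm_wirtinger_le (p q : ℂ) : ‖wirtinger p q‖ ≤ ‖p‖ + ‖q‖ := by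
  refine ContinuousLinearMap.opNorm_le_bound _ (by positivity) fun v => ?_
  rw [wirtinger_apply]
  refine (norm_add_le _ _).trans (le_of_eq ?_)
  simp only [norm_mul, RCLike.norm_conj]
  ring

lemma wirtinger_zero : wirtinger 0 0 = 0 := by
  ext v
  simp [wirtinger_apply]

lemma HasFDerivAt.mul_wirtinger {f g : ℂ → ℂ} {p q p' q' z : ℂ}
    (hf : HasFDerivAt f (wirtinger p q) z) (hg : HasFDerivAt g (wirtinger p' q') z) :
    HasFDerivAt (fun w => f w * g w)
      (wirtinger (p * g z + f z * p') (q * g z + f z * q')) z := by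
  refine (hf.mul hg).congr_fderiv ?_
  refine ContinuousLinearMap.ext fun v => ?_
  simp [wirtinger]
  ring

lemma HasFDerivAt.add_wirtinger {f g : ℂ → ℂ} {p q p' q' z : ℂ}
    (hf : HasFDerivAt f (wirtinger p q) z) (hg : HasFDerivAt g (wirtinger p' q') z) :
    HasFDerivAt (fun w => f w + g w) (wirtinger (p + p') (q + q')) z := by
  refine (hf.add hg).congr_fderiv ?_
  refine ContinuousLinearMap.ext fun v => ?_
  simp [wirtinger]
  ring

lemma HasFDerivAt.const_mul_wirtinger {f : ℂ → ℂ} {p q z : ℂ} (c : ℂ)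
    (hf : HasFDerivAt f (wirtinger p q) z) :
    HasFDerivAt (fun w => c * f w) (wirtinger (c * p) (c * q)) z := by
  refine (hf.const_mul c).congr_fderiv ?_
  refine ContinuousLinearMap.ext fun v => ?_
  simp [wirtinger]
  ring

lemma hasFDerivAt_pow_wirtinger (n : ℕ) (z : ℂ) :
    HasFDerivAt (fun w : ℂ => w ^ (n + 1)) (wirtinger ((n + 1) * z ^ n) 0) z := by
  have h := ((hasDerivAt_pow (n + 1) z).hasFDerivAt).restrictScalars ℝ
  refine h.congr_fderiv ?_
  refine ContinuousLinearMap.ext fun v => ?_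
  simp [wirtinger]
  ring

lemma hasFDerivAt_conj_inv_pow_wirtinger (n : ℕ) {z : ℂ} (hz : z ≠ 0) :
    HasFDerivAt (fun w : ℂ => ((starRingEnd ℂ) w)⁻¹ ^ n)
      (wirtinger 0 (-n * ((starRingEnd ℂ) z)⁻¹ ^ (n + 1))) z := by
  have hz' : (starRingEnd ℂ) z ≠ 0 := by simpa using hz
  have h1 := (((hasDerivAt_inv hz').pow n).hasFDerivAt).restrictScalars ℝ
  have h2 : HasFDerivAt (fun w : ℂ => (starRingEnd ℂ) w) (Complex.conjCLE : ℂ →L[ℝ] ℂ) z :=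
    (Complex.conjCLE : ℂ →L[ℝ] ℂ).hasFDerivAt
  have h3 := h1.comp z h2
  refine h3.congr_fderiv ?_
  rcases n with _ | n
  · ext; simp [wirtinger]
  · refine ContinuousLinearMap.ext fun v => ?_
    rw [wirtinger_apply]
    simp
    field_simp
    ring

lemma hasFDerivAt_radial_wirtinger {h : ℝ → ℝ} {h' : ℝ} {z : ℂ} (hz : z ≠ 0)
    (hh : HasDerivAt h h' ‖z‖) :
    HasFDerivAt (fun w : ℂ => ((h ‖w‖ : ℝ) : ℂ))
      (wirtinger (h' / 2 * (z / ‖z‖)⁻¹) (h' / 2 * (z / ‖z‖))) z := by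
  have hr : ‖z‖ ≠ 0 := by simpa using hz
  have h1 : HasFDerivAt (fun w : ℂ => ‖w‖ ^ 2) _ z := (hasStrictFDerivAt_norm_sq z).hasFDerivAt
  have h2 := h1.sqrt (by positivity)
  simp only [Real.sqrt_sq (norm_nonneg _)] at h2
  have h3 := Complex.ofRealCLM.hasFDerivAt.comp z (hh.comp_hasFDerivAt z h2)
  refine h3.congr_fderiv (ContinuousLinearMap.ext fun v => ?_)
  have hrc : (‖z‖ : ℂ) ≠ 0 := by exact_mod_cast hr
  have hin : ((inner ℝ z v : ℝ) : ℂ) = ((starRingEnd ℂ) z * v + z * (starRingEnd ℂ) v) / 2 := by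
    rw [Complex.inner]
    rw [Complex.re_eq_add_conj]; simp; ring
  have hn : (‖z‖ : ℂ) ^ 2 = z * (starRingEnd ℂ) z := by
    rw [Complex.mul_conj, Complex.normSq_eq_norm_sq]; norm_cast
  rw [wirtinger_apply]
  have hv : (Complex.ofRealCLM ∘SL (h' • (1 / (2 * ‖z‖)) • 2 • (innerSL ℝ) z)) v
      = h' * (1 / (2 * ‖z‖) * (2 * (inner ℝ z v : ℝ))) := by
    simp [-Complex.inner]
  rw [hv, hin]
  field_simp
  rw [hn]
  ring

lemma exists_polar {z : ℂ} (hz : z ≠ 0) : ∃ e : ℂ, e ≠ 0 ∧ ‖e‖ = 1 ∧ z / ‖z‖ = e ∧ z = ‖z‖ * e ∧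
    ((starRingEnd ℂ) z)⁻¹ = e / ‖z‖ := by
  have hr : (‖z‖ : ℂ) ≠ 0 := by simpa using hz
  have hn : (‖z‖ : ℂ) ^ 2 = z * (starRingEnd ℂ) z := by
    rw [Complex.mul_conj, Complex.normSq_eq_norm_sq]; norm_cast
  refine ⟨z / ‖z‖, div_ne_zero hz hr, by simp [hz], rfl, by field_simp, ?_⟩
  have hc : (starRingEnd ℂ) z ≠ 0 := by simpa using hz
  field_simp
  rw [hn, mul_comm]

/-- The coefficient of `z ^ (m + 4)` in the solution of the Poisson equation with right-hand side
`F(|z|) (z/|z|) ^ (m + 4)`, up to normalization. -/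
noncomputable def outerCoeff (m : ℕ) (F : ℝ → ℝ) (r : ℝ) : ℝ :=
  ∫ s in r..2, F s / s ^ (m + 3)

/-- The coefficient of `z̄ ^ (-(m + 4))` in the solution of the Poisson equation with right-hand
side `F(|z|) (z/|z|) ^ (m + 4)`, up to normalization. -/
noncomputable def innerCoeff (m : ℕ) (F : ℝ → ℝ) (r : ℝ) : ℝ :=
  ∫ s in (0 : ℝ)..r, F s * s ^ (m + 5)

/-- `K` dominates `F` on `[0, r]`, and `K s / r` dominates `F s` for `s ∈ [r, 2]`. -/
def LinearlyDominated (F : ℝ → ℝ) (r K : ℝ) : Prop :=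
  (∀ s ∈ Icc 0 r, |F s| ≤ K) ∧ ∀ s ∈ Icc r 2, r * |F s| ≤ K * s

lemma LinearlyDominated.nonneg {F : ℝ → ℝ} {r K : ℝ} (h : LinearlyDominated F r K) (hr : 0 ≤ r) :
    0 ≤ K := (abs_nonneg _).trans (h.1 r ⟨hr, le_rfl⟩)

lemma hasDerivAt_outerCoeff {m : ℕ} {F : ℝ → ℝ} (hF : Continuous F) {r : ℝ} (hr : 0 < r) :
    HasDerivAt (outerCoeff m F) (-(F r / r ^ (m + 3))) r := by
  have hc : ContinuousOn (fun s => F s / s ^ (m + 3)) (Ioi 0) :=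
    hF.continuousOn.div (by fun_prop) fun s hs => (pow_pos hs _).ne'
  refine intervalIntegral.integral_hasDerivAt_left ?_ ?_ (hc.continuousAt (Ioi_mem_nhds hr))
  · refine (hc.mono fun s hs => ?_).intervalIntegrable
    exact (lt_min hr two_pos).trans_le hs.1
  · exact hc.stronglyMeasurableAtFilter isOpen_Ioi r hr

lemma hasDerivAt_innerCoeff {m : ℕ} {F : ℝ → ℝ} (hF : Continuous F) (r : ℝ) :
    HasDerivAt (innerCoeff m F) (F r * r ^ (m + 5)) r := by
  have hc : Continuous (fun s => F s * s ^ (m + 5)) := by fun_prop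
  exact intervalIntegral.integral_hasDerivAt_right (hc.intervalIntegrable _ _)
    hc.stronglyMeasurable.stronglyMeasurableAtFilter hc.continuousAt

lemma abs_outerCoeff_mul_le {m : ℕ} {F : ℝ → ℝ} {r K : ℝ} (hr : 0 < r) (hr2 : r ≤ 2)
    (hK : LinearlyDominated F r K) : |outerCoeff m F r| * r ^ (m + 2) ≤ K := by
  have hK0 := hK.nonneg hr.le
  have hd : ∀ s ∈ uIcc r 2, HasDerivAt (fun s : ℝ => -(K / r ^ (m + 1)) * s⁻¹)
      (K / r ^ (m + 1) / s ^ 2) s := by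
    intro s hs
    rw [uIcc_of_le hr2] at hs
    have hs0 : s ≠ 0 := (hr.trans_le hs.1).ne'
    exact ((hasDerivAt_inv hs0).const_mul (-(K / r ^ (m + 1)))).congr_deriv (by ring)
  have hint : IntervalIntegrable (fun s : ℝ => K / r ^ (m + 1) / s ^ 2) volume r 2 := by
    refine ContinuousOn.intervalIntegrable (continuousOn_const.div (by fun_prop) fun s hs => ?_)
    rw [uIcc_of_le hr2] at hs
    exact (pow_pos (hr.trans_le hs.1) _).ne'
  have h1 : ‖outerCoeff m F r‖ ≤ ∫ s in r..2, K / r ^ (m + 1) / s ^ 2 := by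
    refine intervalIntegral.norm_integral_le_of_norm_le hr2 (ae_of_all _ fun s hs => ?_) hint
    have hs0 : 0 < s := hr.trans hs.1
    rw [norm_div, norm_pow, Real.norm_eq_abs, Real.norm_eq_abs, abs_of_pos hs0, div_div,
      div_le_div_iff₀ (by positivity) (by positivity)]
    have h2 := hK.2 s ⟨hs.1.le, hs.2⟩
    have h3 : r ^ m ≤ s ^ m := pow_le_pow_left₀ hr.le hs.1.le m
    calc |F s| * (r ^ (m + 1) * s ^ 2) = (r * |F s|) * (r ^ m * s ^ 2) := by ring
      _ ≤ (K * s) * (s ^ m * s ^ 2) := by gcongr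
      _ = K * s ^ (m + 3) := by ring
  rw [intervalIntegral.integral_eq_sub_of_hasDerivAt hd hint, Real.norm_eq_abs] at h1
  calc |outerCoeff m F r| * r ^ (m + 2)
      ≤ (K / r ^ (m + 1) * r⁻¹) * r ^ (m + 2) := by
        gcongr
        have : 0 ≤ K / r ^ (m + 1) := by positivity
        linarith
    _ = K := by field_simp; ring

lemma abs_innerCoeff_mul_le {m : ℕ} {F : ℝ → ℝ} {r K : ℝ} (hr : 0 < r)
    (hK : LinearlyDominated F r K) : |innerCoeff m F r| * r⁻¹ ^ (m + 6) ≤ K := by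
  have hK0 := hK.nonneg hr.le
  have h1 : ‖innerCoeff m F r‖ ≤ K * r ^ (m + 5) * |r - 0| := by
    refine intervalIntegral.norm_integral_le_of_norm_le_const fun s hs => ?_
    rw [uIoc_of_le hr.le] at hs
    rw [norm_mul, norm_pow, Real.norm_eq_abs, Real.norm_eq_abs, abs_of_pos hs.1]
    have h2 := hK.1 s ⟨hs.1.le, hs.2⟩
    have h3 := pow_le_pow_left₀ hs.1.le hs.2 (m + 5)
    have h4 := pow_nonneg hs.1.le (m + 5)
    gcongr
  rw [Real.norm_eq_abs, sub_zero, abs_of_pos hr] at h1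
  calc |innerCoeff m F r| * r⁻¹ ^ (m + 6) ≤ (K * r ^ (m + 5) * r) * r⁻¹ ^ (m + 6) := by gcongr
    _ = K := by rw [inv_pow]; field_simp; ring

section Mode

variable (m : ℕ) (F : ℝ → ℝ)

/-- A solution of the Poisson equation with right-hand side proportional to
`F(|z|) (z/|z|) ^ (m + 4)`. -/
noncomputable def mode (z : ℂ) : ℂ :=
  outerCoeff m F ‖z‖ * z ^ (m + 4) + innerCoeff m F ‖z‖ * ((starRingEnd ℂ) z)⁻¹ ^ (m + 4)

/-- `∂ mode`. -/
noncomputable def modeD (z : ℂ) : ℂ := (m + 4) * (outerCoeff m F ‖z‖ * z ^ (m + 3))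

/-- `∂̄ mode`. -/
noncomputable def modeDbar (z : ℂ) : ℂ :=
  (-(m + 4)) * (innerCoeff m F ‖z‖ * ((starRingEnd ℂ) z)⁻¹ ^ (m + 5))

/-- `∂∂ mode`. -/
noncomputable def modeDD (z : ℂ) : ℂ :=
  (m + 4) * ((m + 3) * (outerCoeff m F ‖z‖ * z ^ (m + 2)) - F ‖z‖ / 2 * (z / ‖z‖) ^ (m + 2))

/-- `∂∂̄ mode`. -/
noncomputable def modeDDbar (z : ℂ) : ℂ := (-(m + 4)) * (F ‖z‖ / 2 * (z / ‖z‖) ^ (m + 4))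

/-- `∂̄∂̄ mode`. -/
noncomputable def modeDbarDbar (z : ℂ) : ℂ :=
  (-(m + 4)) * (-(m + 5) * (innerCoeff m F ‖z‖ * ((starRingEnd ℂ) z)⁻¹ ^ (m + 6))
    + F ‖z‖ / 2 * (z / ‖z‖) ^ (m + 6))

variable {m F}

lemma norm_outer_le {z : ℂ} {K : ℝ} (hz : z ≠ 0) (hz2 : ‖z‖ ≤ 2)
    (hK : LinearlyDominated F ‖z‖ K) (j : ℕ) :
    ‖(outerCoeff m F ‖z‖ : ℂ) * z ^ (m + 2 + j)‖ ≤ K * ‖z‖ ^ j := by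
  rw [norm_mul, norm_pow, Complex.norm_real, Real.norm_eq_abs, pow_add, ← mul_assoc]
  gcongr
  exact abs_outerCoeff_mul_le (norm_pos_iff.2 hz) hz2 hK

lemma norm_inner_le {z : ℂ} {K : ℝ} (hz : z ≠ 0)
    (hK : LinearlyDominated F ‖z‖ K) (j i : ℕ) (hij : j + i = m + 6) :
    ‖(innerCoeff m F ‖z‖ : ℂ) * ((starRingEnd ℂ) z)⁻¹ ^ j‖ ≤ K * ‖z‖ ^ i := by
  have hr : 0 < ‖z‖ := norm_pos_iff.2 hz
  have h := abs_innerCoeff_mul_le (m := m) hr hK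
  rw [norm_mul, norm_pow, Complex.norm_real, Real.norm_eq_abs, norm_inv, RCLike.norm_conj]
  calc |innerCoeff m F ‖z‖| * ‖z‖⁻¹ ^ j
      = (|innerCoeff m F ‖z‖| * ‖z‖⁻¹ ^ (m + 6)) * ‖z‖ ^ i := by
        rw [← hij, pow_add, inv_pow, inv_pow]; field_simp
    _ ≤ K * ‖z‖ ^ i := by gcongr

lemma norm_angular_le {z : ℂ} {K : ℝ} (hK : LinearlyDominated F ‖z‖ K) (hz : z ≠ 0) (j : ℕ) :
    ‖(F ‖z‖ : ℂ) / 2 * (z / ‖z‖) ^ j‖ ≤ K / 2 := by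
  obtain ⟨e, -, he, h, -, -⟩ := exists_polar hz
  rw [h, norm_mul, norm_pow, he, one_pow, mul_one, norm_div, Complex.norm_real, Real.norm_eq_abs]
  have := hK.1 _ ⟨norm_nonneg z, le_rfl⟩
  simp only [Complex.norm_ofNat]
  gcongr

lemma norm_mode_le {z : ℂ} {K : ℝ} (hz2 : ‖z‖ ≤ 2) (hK : LinearlyDominated F ‖z‖ K) :
    ‖mode m F z‖ ≤ 2 * (m + 6) ^ 2 * K * ‖z‖ ^ 2 ∧
    ‖modeD m F z‖ ≤ 2 * (m + 6) ^ 2 * K * ‖z‖ ∧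
    ‖modeDbar m F z‖ ≤ 2 * (m + 6) ^ 2 * K * ‖z‖ ∧
    ‖modeDD m F z‖ ≤ 2 * (m + 6) ^ 2 * K ∧
    ‖modeDDbar m F z‖ ≤ 2 * (m + 6) ^ 2 * K ∧
    ‖modeDbarDbar m F z‖ ≤ 2 * (m + 6) ^ 2 * K := by
  have hK0 : 0 ≤ K := hK.nonneg (norm_nonneg z)
  rcases eq_or_ne z 0 with rfl | hz
  · simp [mode, modeD, modeDbar, modeDD, modeDDbar, modeDbarDbar]
    positivity
  have hr : 0 < ‖z‖ := norm_pos_iff.2 hz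
  have hm : (0 : ℝ) ≤ m := m.cast_nonneg
  have e4 : ‖(m + 4 : ℂ)‖ = m + 4 := by
    rw [show (m + 4 : ℂ) = ((m + 4 : ℝ) : ℂ) by push_cast; rfl, Complex.norm_real,
      Real.norm_of_nonneg (by positivity)]
  have e3 : ‖(m + 3 : ℂ)‖ = m + 3 := by
    rw [show (m + 3 : ℂ) = ((m + 3 : ℝ) : ℂ) by push_cast; rfl, Complex.norm_real,
      Real.norm_of_nonneg (by positivity)]
  have e5 : ‖(m + 5 : ℂ)‖ = m + 5 := by
    rw [show (m + 5 : ℂ) = ((m + 5 : ℝ) : ℂ) by push_cast; rfl, Complex.norm_real,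
      Real.norm_of_nonneg (by positivity)]
  have o0 := norm_outer_le (m := m) hz hz2 hK 0
  have o1 := norm_outer_le (m := m) hz hz2 hK 1
  have o2 := norm_outer_le (m := m) hz hz2 hK 2
  have i0 := norm_inner_le (m := m) hz hK (m + 6) 0 rfl
  have i1 := norm_inner_le (m := m) hz hK (m + 5) 1 rfl
  have i2 := norm_inner_le (m := m) hz hK (m + 4) 2 rfl
  have a0 := norm_angular_le hK hz (m + 2)
  have a1 := norm_angular_le hK hz (m + 4)
  have a2 := norm_angular_le hK hz (m + 6)
  simp only [pow_zero, pow_one, mul_one, add_zero] at o0 o1 i0 i1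
  refine ⟨?_, ?_, ?_, ?_, ?_, ?_⟩
  · refine (norm_add_le _ _).trans ((add_le_add o2 i2).trans ?_)
    rw [← add_mul, ← two_mul, mul_assoc 2 _ K]
    gcongr
    exact le_mul_of_one_le_left hK0 (by nlinarith)
  · rw [modeD, norm_mul, e4]
    calc (m + 4 : ℝ) * _ ≤ (m + 4) * (K * ‖z‖) := by gcongr
      _ = (m + 4) * K * ‖z‖ := by ring
      _ ≤ 2 * (m + 6) ^ 2 * K * ‖z‖ := by gcongr ?_ * K * ‖z‖; nlinarith
  · rw [modeDbar, norm_mul, norm_neg, e4]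
    calc (m + 4 : ℝ) * _ ≤ (m + 4) * (K * ‖z‖) := by gcongr
      _ = (m + 4) * K * ‖z‖ := by ring
      _ ≤ 2 * (m + 6) ^ 2 * K * ‖z‖ := by gcongr ?_ * K * ‖z‖; nlinarith
  · rw [modeDD, norm_mul, e4]
    calc (m + 4 : ℝ) * _ ≤ (m + 4) * ((m + 3) * K + K / 2) := by
          gcongr
          refine (norm_sub_le _ _).trans (add_le_add ?_ a0)
          rw [norm_mul, e3]
          gcongr
      _ = ((m + 4) * (m + 3 + 1 / 2)) * K := by ring
      _ ≤ 2 * (m + 6) ^ 2 * K := by gcongr ?_ * K; nlinarith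
  · rw [modeDDbar, norm_mul, norm_neg, e4]
    calc (m + 4 : ℝ) * _ ≤ (m + 4) * (K / 2) := by gcongr
      _ = ((m + 4) / 2) * K := by ring
      _ ≤ 2 * (m + 6) ^ 2 * K := by gcongr ?_ * K; nlinarith
  · rw [modeDbarDbar, norm_mul, norm_neg, e4]
    calc (m + 4 : ℝ) * _ ≤ (m + 4) * ((m + 5) * K + K / 2) := by
          gcongr
          refine (norm_add_le _ _).trans (add_le_add ?_ a2)
          rw [norm_mul, norm_neg, e5]
          gcongr
      _ = ((m + 4) * (m + 5 + 1 / 2)) * K := by ring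
      _ ≤ 2 * (m + 6) ^ 2 * K := by gcongr ?_ * K; nlinarith

lemma hasFDerivAt_outer (hF : Continuous F) {z : ℂ} (hz : z ≠ 0) :
    HasFDerivAt (fun w : ℂ => (outerCoeff m F ‖w‖ : ℂ))
      (wirtinger (-(F ‖z‖ / ‖z‖ ^ (m + 3)) / 2 * (z / ‖z‖)⁻¹)
        (-(F ‖z‖ / ‖z‖ ^ (m + 3)) / 2 * (z / ‖z‖))) z := by
  have h := hasFDerivAt_radial_wirtinger hz
    (hasDerivAt_outerCoeff (m := m) hF (norm_pos_iff.2 hz))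
  push_cast at h
  exact h

lemma hasFDerivAt_inner (hF : Continuous F) {z : ℂ} (hz : z ≠ 0) :
    HasFDerivAt (fun w : ℂ => (innerCoeff m F ‖w‖ : ℂ))
      (wirtinger ((F ‖z‖ * ‖z‖ ^ (m + 5)) / 2 * (z / ‖z‖)⁻¹)
        ((F ‖z‖ * ‖z‖ ^ (m + 5)) / 2 * (z / ‖z‖))) z := by
  have h := hasFDerivAt_radial_wirtinger hz (hasDerivAt_innerCoeff (m := m) hF ‖z‖)
  push_cast at h
  exact h

lemma hasFDerivAt_mode_of_ne (hF : Continuous F) {z : ℂ} (hz : z ≠ 0) :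
    HasFDerivAt (mode m F) (wirtinger (modeD m F z) (modeDbar m F z)) z := by
  have h := ((hasFDerivAt_outer (m := m) hF hz).mul_wirtinger
    (hasFDerivAt_pow_wirtinger (m + 3) z)).add_wirtinger
    ((hasFDerivAt_inner (m := m) hF hz).mul_wirtinger
      (hasFDerivAt_conj_inv_pow_wirtinger (m + 4) hz))
  refine h.congr_fderiv ?_
  obtain ⟨e, he0, -, he, hz1, hz2⟩ := exists_polar hz
  have hr : (‖z‖ : ℂ) ≠ 0 := by simpa using hz
  rw [he]
  congr 1
  · rw [modeD, hz2]
    generalize (‖z‖ : ℂ) = r at *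
    rw [hz1]; simp only [div_pow]; push_cast; field_simp; ring
  · rw [modeDbar, hz2]
    generalize (‖z‖ : ℂ) = r at *
    rw [hz1]; simp only [div_pow]; push_cast; field_simp; ring

lemma hasFDerivAt_modeD_of_ne (hF : Continuous F) {z : ℂ} (hz : z ≠ 0) :
    HasFDerivAt (modeD m F) (wirtinger (modeDD m F z) (modeDDbar m F z)) z := by
  have h := ((hasFDerivAt_outer (m := m) hF hz).mul_wirtinger
    (hasFDerivAt_pow_wirtinger (m + 2) z)).const_mul_wirtinger (m + 4 : ℂ)
  refine h.congr_fderiv ?_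
  obtain ⟨e, he0, -, he, hz1, hz2⟩ := exists_polar hz
  have hr : (‖z‖ : ℂ) ≠ 0 := by simpa using hz
  congr 1
  · rw [modeDD, he]
    generalize (‖z‖ : ℂ) = r at *
    rw [hz1]; push_cast; field_simp; ring
  · rw [modeDDbar, he]
    generalize (‖z‖ : ℂ) = r at *
    rw [hz1]; field_simp; ring

lemma hasFDerivAt_modeDbar_of_ne (hF : Continuous F) {z : ℂ} (hz : z ≠ 0) :
    HasFDerivAt (modeDbar m F) (wirtinger (modeDDbar m F z) (modeDbarDbar m F z)) z := by
  have h := ((hasFDerivAt_inner (m := m) hF hz).mul_wirtinger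
    (hasFDerivAt_conj_inv_pow_wirtinger (m + 5) hz)).const_mul_wirtinger (-(m + 4) : ℂ)
  refine h.congr_fderiv ?_
  obtain ⟨e, he0, -, he, hz1, hz2⟩ := exists_polar hz
  have hr : (‖z‖ : ℂ) ≠ 0 := by simpa using hz
  congr 1
  · rw [modeDDbar, he, hz2]
    generalize (‖z‖ : ℂ) = r at *
    simp only [div_pow]; field_simp; ring
  · rw [modeDbarDbar, he, hz2]
    generalize (‖z‖ : ℂ) = r at *
    simp only [div_pow]; push_cast; field_simp; ring

end Mode

lemma linearlyDominated_of_le_mul {F : ℝ → ℝ} {L r : ℝ} (hL : ∀ s ∈ Icc (0 : ℝ) 2, |F s| ≤ L * s)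
    (hr : 0 ≤ r) (hr2 : r ≤ 2) : LinearlyDominated F r (L * r) := by
  have hL0 : 0 ≤ L := by
    have := (abs_nonneg _).trans (hL 2 ⟨by norm_num, le_rfl⟩)
    linarith
  refine ⟨fun s hs => ?_, fun s hs => ?_⟩
  · exact (hL s ⟨hs.1, hs.2.trans hr2⟩).trans (mul_le_mul_of_nonneg_left hs.2 hL0)
  · have := mul_le_mul_of_nonneg_left (hL s ⟨hr.trans hs.1, hs.2⟩) hr
    linarith

lemma continuousAt_zero_of_norm_le {f : ℂ → ℂ} {C : ℝ}
    (h : ∀ z : ℂ, ‖z‖ ≤ 2 → ‖f z‖ ≤ C * ‖z‖) : ContinuousAt f 0 := by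
  have h0 : f 0 = 0 := by simpa using h 0 (by simp)
  rw [ContinuousAt, h0]
  refine squeeze_zero_norm' (a := fun z => C * ‖z‖) ?_ ?_
  · filter_upwards [Metric.closedBall_mem_nhds (0 : ℂ) two_pos] with z hz
    exact h z (by simpa using hz)
  · have : Continuous fun z : ℂ => C * ‖z‖ := by fun_prop
    simpa using this.tendsto 0

lemma hasFDerivAt_zero_of_norm_le {f : ℂ → ℂ} {C : ℝ}
    (h : ∀ z : ℂ, ‖z‖ ≤ 2 → ‖f z‖ ≤ C * ‖z‖ ^ 2) : HasFDerivAt f (0 : ℂ →L[ℝ] ℂ) 0 := by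
  refine Asymptotics.IsBigO.hasFDerivAt (n := 2) ?_ one_lt_two
  refine Asymptotics.IsBigO.of_bound C ?_
  filter_upwards [Metric.closedBall_mem_nhds (0 : ℂ) two_pos] with z hz
  simpa using h z (by simpa using hz)

section ModeRegularity

variable {m : ℕ} {F : ℝ → ℝ} {L : ℝ}

lemma hasFDerivAt_mode (hF : Continuous F) (hL : ∀ s ∈ Icc (0 : ℝ) 2, |F s| ≤ L * s) (z : ℂ) :
    HasFDerivAt (mode m F) (wirtinger (modeD m F z) (modeDbar m F z)) z := by
  rcases eq_or_ne z 0 with rfl | hz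
  · have h : HasFDerivAt (mode m F) (0 : ℂ →L[ℝ] ℂ) 0 := by
      refine hasFDerivAt_zero_of_norm_le (C := 2 * (m + 6) ^ 2 * (L * 2)) fun z hz => ?_
      have hK := linearlyDominated_of_le_mul hL (norm_nonneg z) hz
      refine (norm_mode_le hz hK).1.trans ?_
      have : L * ‖z‖ ≤ L * 2 := by
        have := (abs_nonneg _).trans (hL 2 ⟨by norm_num, le_rfl⟩)
        nlinarith
      gcongr
    refine h.congr_fderiv ?_
    simp [modeD, modeDbar, wirtinger_zero]
  · exact hasFDerivAt_mode_of_ne hF hz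

lemma hasFDerivAt_modeD (hF : Continuous F) (hL : ∀ s ∈ Icc (0 : ℝ) 2, |F s| ≤ L * s) (z : ℂ) :
    HasFDerivAt (modeD m F) (wirtinger (modeDD m F z) (modeDDbar m F z)) z := by
  rcases eq_or_ne z 0 with rfl | hz
  · have h : HasFDerivAt (modeD m F) (0 : ℂ →L[ℝ] ℂ) 0 := by
      refine hasFDerivAt_zero_of_norm_le (C := 2 * (m + 6) ^ 2 * L) fun z hz => ?_
      have hK := linearlyDominated_of_le_mul hL (norm_nonneg z) hz
      exact (norm_mode_le hz hK).2.1.trans (le_of_eq (by ring))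
    refine h.congr_fderiv ?_
    simp [modeDD, modeDDbar, wirtinger_zero]
  · exact hasFDerivAt_modeD_of_ne hF hz

lemma hasFDerivAt_modeDbar (hF : Continuous F) (hL : ∀ s ∈ Icc (0 : ℝ) 2, |F s| ≤ L * s)
    (z : ℂ) :
    HasFDerivAt (modeDbar m F) (wirtinger (modeDDbar m F z) (modeDbarDbar m F z)) z := by
  rcases eq_or_ne z 0 with rfl | hz
  · have h : HasFDerivAt (modeDbar m F) (0 : ℂ →L[ℝ] ℂ) 0 := by
      refine hasFDerivAt_zero_of_norm_le (C := 2 * (m + 6) ^ 2 * L) fun z hz => ?_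
      have hK := linearlyDominated_of_le_mul hL (norm_nonneg z) hz
      exact (norm_mode_le hz hK).2.2.1.trans (le_of_eq (by ring))
    refine h.congr_fderiv ?_
    simp [modeDbarDbar, modeDDbar, wirtinger_zero]
  · exact hasFDerivAt_modeDbar_of_ne hF hz

lemma continuousAt_angular (hF : Continuous F) {z : ℂ} (hz : z ≠ 0) (j : ℕ) :
    ContinuousAt (fun w : ℂ => (F ‖w‖ : ℂ) / 2 * (w / ‖w‖) ^ j) z := by
  have hr : (‖z‖ : ℂ) ≠ 0 := by simpa using hz
  have h1 : Continuous fun w : ℂ => (F ‖w‖ : ℂ) / 2 := by fun_prop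
  have h2 : ContinuousAt (fun w : ℂ => w / (‖w‖ : ℂ)) z := by
    refine ContinuousAt.div continuousAt_id ?_ hr
    fun_prop
  exact h1.continuousAt.mul (h2.pow j)

lemma continuous_modeDD (hF : Continuous F) (hL : ∀ s ∈ Icc (0 : ℝ) 2, |F s| ≤ L * s) :
    Continuous (modeDD m F) := by
  refine continuous_iff_continuousAt.2 fun z => ?_
  rcases eq_or_ne z 0 with rfl | hz
  · refine continuousAt_zero_of_norm_le (C := 2 * (m + 6) ^ 2 * L) fun z hz => ?_
    have hK := linearlyDominated_of_le_mul hL (norm_nonneg z) hz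
    exact (norm_mode_le hz hK).2.2.2.1.trans (le_of_eq (by ring))
  · have h1 := (hasFDerivAt_outer (m := m) hF hz).continuousAt
    have h2 := continuousAt_angular hF hz (m + 2)
    unfold modeDD
    fun_prop

lemma continuous_modeDDbar (hF : Continuous F) (hL : ∀ s ∈ Icc (0 : ℝ) 2, |F s| ≤ L * s) :
    Continuous (modeDDbar m F) := by
  refine continuous_iff_continuousAt.2 fun z => ?_
  rcases eq_or_ne z 0 with rfl | hz
  · refine continuousAt_zero_of_norm_le (C := 2 * (m + 6) ^ 2 * L) fun z hz => ?_
    have hK := linearlyDominated_of_le_mul hL (norm_nonneg z) hz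
    exact (norm_mode_le hz hK).2.2.2.2.1.trans (le_of_eq (by ring))
  · have h2 := continuousAt_angular hF hz (m + 4)
    unfold modeDDbar
    fun_prop

lemma continuous_modeDbarDbar (hF : Continuous F) (hL : ∀ s ∈ Icc (0 : ℝ) 2, |F s| ≤ L * s) :
    Continuous (modeDbarDbar m F) := by
  refine continuous_iff_continuousAt.2 fun z => ?_
  rcases eq_or_ne z 0 with rfl | hz
  · refine continuousAt_zero_of_norm_le (C := 2 * (m + 6) ^ 2 * L) fun z hz => ?_
    have hK := linearlyDominated_of_le_mul hL (norm_nonneg z) hz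
    exact (norm_mode_le hz hK).2.2.2.2.2.trans (le_of_eq (by ring))
  · have h1 := (hasFDerivAt_inner (m := m) hF hz).continuousAt
    have h2 := continuousAt_angular hF hz (m + 6)
    have h3 := (hasFDerivAt_conj_inv_pow_wirtinger (m + 6) hz).continuousAt
    unfold modeDbarDbar
    fun_prop

end ModeRegularity

lemma hasFDerivAt_tsum_wirtinger {f p q : ℕ → ℂ → ℂ} {u : ℕ → ℝ} {R : ℝ} (hu : Summable u)
    (h : ∀ k z, HasFDerivAt (f k) (wirtinger (p k z) (q k z)) z)
    (hf : ∀ k, ∀ z ∈ Metric.ball (0 : ℂ) R, ‖f k z‖ ≤ u k)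
    (hp : ∀ k, ∀ z ∈ Metric.ball (0 : ℂ) R, ‖p k z‖ ≤ u k)
    (hq : ∀ k, ∀ z ∈ Metric.ball (0 : ℂ) R, ‖q k z‖ ≤ u k) {z : ℂ}
    (hz : z ∈ Metric.ball (0 : ℂ) R) :
    HasFDerivAt (fun w => ∑' k, f k w) (wirtinger (∑' k, p k z) (∑' k, q k z)) z := by
  have hs : ∀ {g : ℕ → ℂ → ℂ}, (∀ k, ∀ z ∈ Metric.ball (0 : ℂ) R, ‖g k z‖ ≤ u k) →
      Summable fun k => g k z := fun hg => Summable.of_norm_bounded hu fun k => hg k z hz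
  have key := hasFDerivAt_tsum_of_isPreconnected (hu.mul_left 2) Metric.isOpen_ball
    (convex_ball (0 : ℂ) R).isPreconnected (fun k w _ => h k w)
    (fun k w hw => (norm_wirtinger_le _ _).trans
      (by rw [two_mul]; exact add_le_add (hp k w hw) (hq k w hw))) hz (hs hf) hz
  refine key.congr_fderiv ?_
  have h1 : HasSum (fun k => wirtinger (p k z) (q k z))
      (wirtinger (∑' k, p k z) (∑' k, q k z)) :=
    ((hs hp).hasSum.smul_const _).add ((hs hq).hasSum.smul_const _)
  exact h1.tsum_eq

lemma contDiffOn_succ_of_wirtinger {f p q : ℂ → ℂ} {U : Set ℂ} (hU : IsOpen U) {n : ℕ}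
    (h : ∀ z ∈ U, HasFDerivAt f (wirtinger (p z) (q z)) z)
    (hp : ContDiffOn ℝ n p U) (hq : ContDiffOn ℝ n q U) : ContDiffOn ℝ (n + 1) f U := by
  rw [contDiffOn_succ_iff_fderiv_of_isOpen hU]
  refine ⟨fun z hz => (h z hz).differentiableAt.differentiableWithinAt, by simp, ?_⟩
  refine ContDiffOn.congr (f := fun z => wirtinger (p z) (q z)) ?_ fun z hz => (h z hz).fderiv
  exact (hp.smul contDiffOn_const).add (hq.smul contDiffOn_const)

/-- A function on a set together with its continuous Wirtinger derivatives up to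
order two. -/
structure SecondOrderJet (f p q pp pq qq : ℂ → ℂ) (U : Set ℂ) : Prop where
  hasFDerivAt : ∀ z ∈ U, HasFDerivAt f (wirtinger (p z) (q z)) z
  hasFDerivAt_d : ∀ z ∈ U, HasFDerivAt p (wirtinger (pp z) (pq z)) z
  hasFDerivAt_dbar : ∀ z ∈ U, HasFDerivAt q (wirtinger (pq z) (qq z)) z
  continuousOn_dd : ContinuousOn pp U
  continuousOn_ddbar : ContinuousOn pq U
  continuousOn_dbardbar : ContinuousOn qq U

lemma SecondOrderJet.contDiffOn {f p q pp pq qq : ℂ → ℂ} {U : Set ℂ}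
    (h : SecondOrderJet f p q pp pq qq U) (hU : IsOpen U) : ContDiffOn ℝ 2 f U := by
  have hp : ContDiffOn ℝ (0 + 1) p U := contDiffOn_succ_of_wirtinger (n := 0) hU h.hasFDerivAt_d
    (contDiffOn_zero.2 h.continuousOn_dd) (contDiffOn_zero.2 h.continuousOn_ddbar)
  have hq : ContDiffOn ℝ (0 + 1) q U := contDiffOn_succ_of_wirtinger (n := 0) hU h.hasFDerivAt_dbar
    (contDiffOn_zero.2 h.continuousOn_ddbar) (contDiffOn_zero.2 h.continuousOn_dbardbar)
  have := contDiffOn_succ_of_wirtinger (n := 1) hU h.hasFDerivAt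
    (by simpa using hp) (by simpa using hq)
  convert this using 1
  norm_num

lemma norm_tsum_mul_le {c : ℕ → ℂ} {w : ℕ → ℝ} (hw : Summable fun k => ‖c k‖ * w k)
    {t : ℕ → ℂ} {B : ℝ} (ht : ∀ k, ‖t k‖ ≤ w k * B) :
    ‖∑' k, c k * t k‖ ≤ (∑' k, ‖c k‖ * w k) * B := by
  refine tsum_of_norm_bounded (hw.hasSum.mul_right B) fun k => ?_
  rw [norm_mul, mul_assoc]
  exact mul_le_mul_of_nonneg_left (ht k) (norm_nonneg _)

lemma exists_secondOrderJet {c : ℕ → ℂ} {w : ℕ → ℝ} {F : ℝ → ℝ} {L : ℝ}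
    (hw : ∀ k, w k = 2 * ((4 * k : ℕ) + 6) ^ 2)
    (hc : Summable fun k => ‖c k‖ * w k) (hF : Continuous F)
    (hL : ∀ s ∈ Icc (0 : ℝ) 2, |F s| ≤ L * s) :
    ∃ f p q pp pq qq : ℂ → ℂ, SecondOrderJet f p q pp pq qq (Metric.ball 0 2) ∧
      (∀ z, pq z = ∑' k, c k * modeDDbar (4 * k) F z) ∧
      ∀ z K, ‖z‖ ≤ 2 → LinearlyDominated F ‖z‖ K →
        ‖f z‖ ≤ (∑' k, ‖c k‖ * w k) * (K * ‖z‖ ^ 2) ∧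
        ‖p z‖ ≤ (∑' k, ‖c k‖ * w k) * (K * ‖z‖) ∧
        ‖q z‖ ≤ (∑' k, ‖c k‖ * w k) * (K * ‖z‖) ∧
        ‖pp z‖ ≤ (∑' k, ‖c k‖ * w k) * K ∧
        ‖pq z‖ ≤ (∑' k, ‖c k‖ * w k) * K ∧
        ‖qq z‖ ≤ (∑' k, ‖c k‖ * w k) * K := by
  have hL0 : 0 ≤ L := by
    have := (abs_nonneg _).trans (hL 2 ⟨by norm_num, le_rfl⟩)
    linarith
  have hw0 : ∀ k, 0 ≤ w k := fun k => by rw [hw]; positivity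
  have hb : ∀ k z K, ‖z‖ ≤ 2 → LinearlyDominated F ‖z‖ K →
      ‖mode (4 * k) F z‖ ≤ w k * (K * ‖z‖ ^ 2) ∧
      ‖modeD (4 * k) F z‖ ≤ w k * (K * ‖z‖) ∧
      ‖modeDbar (4 * k) F z‖ ≤ w k * (K * ‖z‖) ∧
      ‖modeDD (4 * k) F z‖ ≤ w k * K ∧
      ‖modeDDbar (4 * k) F z‖ ≤ w k * K ∧
      ‖modeDbarDbar (4 * k) F z‖ ≤ w k * K := by
    intro k z K hz hK
    have := norm_mode_le (m := 4 * k) hz hK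
    rw [← hw k] at this
    simpa only [mul_assoc] using this
  have hu : Summable fun k => ‖c k‖ * w k * (8 * L) := hc.mul_right _
  have hub : ∀ k, ∀ z ∈ Metric.ball (0 : ℂ) 2,
      ‖c k * mode (4 * k) F z‖ ≤ ‖c k‖ * w k * (8 * L) ∧
      ‖c k * modeD (4 * k) F z‖ ≤ ‖c k‖ * w k * (8 * L) ∧
      ‖c k * modeDbar (4 * k) F z‖ ≤ ‖c k‖ * w k * (8 * L) ∧
      ‖c k * modeDD (4 * k) F z‖ ≤ ‖c k‖ * w k * (8 * L) ∧
      ‖c k * modeDDbar (4 * k) F z‖ ≤ ‖c k‖ * w k * (8 * L) ∧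
      ‖c k * modeDbarDbar (4 * k) F z‖ ≤ ‖c k‖ * w k * (8 * L) := by
    intro k z hz
    have hz2 : ‖z‖ ≤ 2 := by simpa using (Metric.mem_ball.1 hz).le
    have hr := norm_nonneg z
    have := hb k z _ hz2 (linearlyDominated_of_le_mul hL hr hz2)
    have h1 : L * ‖z‖ ≤ 8 * L := by nlinarith
    have h2 : L * ‖z‖ * ‖z‖ ≤ 8 * L := by
      have : ‖z‖ * ‖z‖ ≤ 4 := by nlinarith
      nlinarith
    have h3 : L * ‖z‖ * ‖z‖ ^ 2 ≤ 8 * L := by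
      have : ‖z‖ * ‖z‖ ^ 2 ≤ 8 := by
        calc ‖z‖ * ‖z‖ ^ 2 ≤ 2 * 2 ^ 2 := by gcongr
          _ = 8 := by norm_num
      nlinarith
    have aux : ∀ {t : ℂ} {B : ℝ}, ‖t‖ ≤ w k * B → B ≤ 8 * L → ‖c k * t‖ ≤ ‖c k‖ * w k * (8 * L) := by
      intro t B ht hB
      rw [norm_mul, mul_assoc]
      exact mul_le_mul_of_nonneg_left (ht.trans (mul_le_mul_of_nonneg_left hB (hw0 k)))
        (norm_nonneg _)
    exact ⟨aux this.1 h3, aux this.2.1 h2, aux this.2.2.1 h2, aux this.2.2.2.1 h1,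
      aux this.2.2.2.2.1 h1, aux this.2.2.2.2.2 h1⟩
  refine ⟨fun z => ∑' k, c k * mode (4 * k) F z, fun z => ∑' k, c k * modeD (4 * k) F z,
    fun z => ∑' k, c k * modeDbar (4 * k) F z, fun z => ∑' k, c k * modeDD (4 * k) F z,
    fun z => ∑' k, c k * modeDDbar (4 * k) F z, fun z => ∑' k, c k * modeDbarDbar (4 * k) F z,
    ⟨fun z hz => ?_, fun z hz => ?_, fun z hz => ?_, ?_, ?_, ?_⟩, fun z => rfl, fun z K hz hK => ?_⟩
  · exact hasFDerivAt_tsum_wirtinger hu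
      (fun k z => (hasFDerivAt_mode hF hL z).const_mul_wirtinger (c k))
      (fun k z hz => (hub k z hz).1) (fun k z hz => (hub k z hz).2.1)
      (fun k z hz => (hub k z hz).2.2.1) hz
  · exact hasFDerivAt_tsum_wirtinger hu
      (fun k z => (hasFDerivAt_modeD hF hL z).const_mul_wirtinger (c k))
      (fun k z hz => (hub k z hz).2.1) (fun k z hz => (hub k z hz).2.2.2.1)
      (fun k z hz => (hub k z hz).2.2.2.2.1) hz
  · exact hasFDerivAt_tsum_wirtinger hu
      (fun k z => (hasFDerivAt_modeDbar hF hL z).const_mul_wirtinger (c k))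
      (fun k z hz => (hub k z hz).2.2.1) (fun k z hz => (hub k z hz).2.2.2.2.1)
      (fun k z hz => (hub k z hz).2.2.2.2.2) hz
  · exact continuousOn_tsum
      (fun k => (continuous_const.mul (continuous_modeDD hF hL)).continuousOn) hu
      (fun k z hz => (hub k z hz).2.2.2.1)
  · exact continuousOn_tsum
      (fun k => (continuous_const.mul (continuous_modeDDbar hF hL)).continuousOn) hu
      (fun k z hz => (hub k z hz).2.2.2.2.1)
  · exact continuousOn_tsum
      (fun k => (continuous_const.mul (continuous_modeDbarDbar hF hL)).continuousOn) hu
      (fun k z hz => (hub k z hz).2.2.2.2.2)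
  · exact ⟨norm_tsum_mul_le hc fun k => (hb k z K hz hK).1,
      norm_tsum_mul_le hc fun k => (hb k z K hz hK).2.1,
      norm_tsum_mul_le hc fun k => (hb k z K hz hK).2.2.1,
      norm_tsum_mul_le hc fun k => (hb k z K hz hK).2.2.2.1,
      norm_tsum_mul_le hc fun k => (hb k z K hz hK).2.2.2.2.1,
      norm_tsum_mul_le hc fun k => (hb k z K hz hK).2.2.2.2.2⟩

lemma exists_norm_fourierCoeffOn_mul_pow_le {T : ℝ} (hT : 0 < T) (p : ℕ) :
    ∀ h : ℝ → ℂ, ContDiff ℝ (⊤ : ℕ∞) h → (∀ x, h (x + T) = h x) →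
      ∃ C, ∀ n : ℤ, n ≠ 0 → ‖fourierCoeffOn hT h n‖ * |(n : ℝ)| ^ p ≤ C := by
  induction p with
  | zero =>
    intro h hh _
    obtain ⟨B, hB⟩ := isCompact_Icc.exists_bound_of_continuousOn (s := Icc 0 T)
      hh.continuous.continuousOn
    refine ⟨|1 / T| * (B * |T|), fun n _ => ?_⟩
    rw [pow_zero, mul_one, fourierCoeffOn_eq_integral, sub_zero, norm_smul, Real.norm_eq_abs]
    gcongr
    have := intervalIntegral.norm_integral_le_of_norm_le_const (a := 0) (b := T) (C := B)
      (f := fun x : ℝ => (fourier (-n) (x : AddCircle (T - 0))) • h x) fun x hx => ?_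
    · simpa using this
    · rw [uIoc_of_le hT.le] at hx
      rw [norm_smul, fourier_apply, Circle.norm_coe, one_mul]
      exact hB x ⟨hx.1.le, hx.2⟩
  | succ p ih =>
    intro h hh hper
    have hd : ContDiff ℝ (⊤ : ℕ∞) (deriv h) := by
      have := (contDiff_infty_iff_deriv.1 hh).2
      exact this
    have hdper : ∀ x, deriv h (x + T) = deriv h x := fun x => by
      rw [← deriv_comp_add_const]
      simp only [hper]
    obtain ⟨C, hC⟩ := ih (deriv h) hd hdper
    refine ⟨T / (2 * π) * C, fun n hn => ?_⟩
    have hn' : (n : ℂ) ≠ 0 := by exact_mod_cast hn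
    have hnr : 0 < |(n : ℝ)| := by positivity
    have key := fourierCoeffOn_of_hasDerivAt hT (f := h) (f' := deriv h) hn
      (fun x _ => (hh.differentiable (by simp) x).hasDerivAt)
      (hd.continuous.intervalIntegrable _ _)
    have h0 : h T = h 0 := by simpa using hper 0
    rw [h0, sub_self, mul_zero, zero_sub] at key
    have hnorm : ‖fourierCoeffOn hT h n‖ * |(n : ℝ)| =
        T / (2 * π) * ‖fourierCoeffOn hT (deriv h) n‖ := by
      rw [key]
      simp [abs_of_pos Real.pi_pos, abs_of_pos hT]
      field_simp
    calc ‖fourierCoeffOn hT h n‖ * |(n : ℝ)| ^ (p + 1)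
        = (‖fourierCoeffOn hT h n‖ * |(n : ℝ)|) * |(n : ℝ)| ^ p := by ring
      _ = T / (2 * π) * (‖fourierCoeffOn hT (deriv h) n‖ * |(n : ℝ)| ^ p) := by
        rw [hnorm]; ring
      _ ≤ T / (2 * π) * C := by
        have := hC n hn
        have := Real.pi_pos
        gcongr

lemma hasSum_fourierCoeffOn {T : ℝ} (hT : 0 < T) {h : ℝ → ℂ} (hc : Continuous h)
    (hper : ∀ x, h (x + T) = h x) (hs : Summable (fourierCoeffOn hT h)) (x : ℝ) :
    HasSum (fun n : ℤ => fourierCoeffOn hT h n * Complex.exp (2 * π * Complex.I * n * x / T))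
      (h x) := by
  have : Fact (0 < T) := ⟨hT⟩
  have hp : Function.Periodic h T := hper
  let H : C(AddCircle T, ℂ) := ⟨hp.lift, continuous_coinduced_dom.2 hc⟩
  have hcoe : ∀ n, fourierCoeff H n = fourierCoeffOn hT h n := by
    intro n
    rw [fourierCoeffOn_eq_integral, fourierCoeff_eq_intervalIntegral _ _ 0, sub_zero, zero_add]
    rfl
  have hs' : Summable (fourierCoeff H) := by
    simpa only [funext hcoe] using hs
  have := has_pointwise_sum_fourier_series_of_summable hs' (x : AddCircle T)
  simp only [hcoe, smul_eq_mul, fourier_coe_apply] at this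
  exact this

lemma summable_of_norm_mul_sq_le {a : ℤ → ℂ} {C : ℝ}
    (h : ∀ n : ℤ, n ≠ 0 → ‖a n‖ * |(n : ℝ)| ^ 2 ≤ C) : Summable a := by
  have h1 : Summable fun n : ℤ => C * (1 / (n : ℝ) ^ 2) :=
    (Real.summable_one_div_int_pow.2 one_lt_two).mul_left C
  refine Summable.of_norm_bounded_eventually h1 ?_
  have hfin : ({0} : Set ℤ).Finite := Set.finite_singleton 0
  filter_upwards [hfin.compl_mem_cofinite] with n hn
  have hn0 : n ≠ 0 := hn
  have hnr : (n : ℝ) ≠ 0 := by exact_mod_cast hn0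
  have := h n hn0
  rw [sq_abs] at this
  rw [mul_one_div, le_div_iff₀ (by positivity)]
  exact this

lemma exists_fourier_expansion {g : ℝ → ℝ} (hg_smooth : ContDiff ℝ (⊤ : ℕ∞) g)
    (hg_per : ∀ θ : ℝ, g (θ + π / 2) = g θ) (hg_mean : ∫ θ in (0:ℝ)..(π/2), g θ = 0) :
    ∃ (d : ℕ → ℂ) (C : ℝ), (∀ k, ‖d k‖ * ((k : ℝ) + 1) ^ 3 ≤ C) ∧
      ∀ θ : ℝ, g θ = (∑' k, d k * Complex.exp (θ * Complex.I) ^ (4 * k + 4)).re := by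
  have hT : 0 < π / 2 := by positivity
  set h : ℝ → ℂ := fun x => (g x : ℂ) with hh
  have hsm : ContDiff ℝ (⊤ : ℕ∞) h := Complex.ofRealCLM.contDiff.comp hg_smooth
  have hper : ∀ x, h (x + π / 2) = h x := fun x => by simp [hh, hg_per]
  set a := fourierCoeffOn hT h with ha
  obtain ⟨C2, hC2⟩ := exists_norm_fourierCoeffOn_mul_pow_le hT 2 h hsm hper
  obtain ⟨C3, hC3⟩ := exists_norm_fourierCoeffOn_mul_pow_le hT 3 h hsm hper
  have ha0 : a 0 = 0 := by
    rw [ha, fourierCoeffOn_eq_integral]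
    simp [hh, intervalIntegral.integral_ofReal, hg_mean]
  have hsum := hasSum_fourierCoeffOn hT hsm.continuous hper (summable_of_norm_mul_sq_le hC2)
  set d : ℕ → ℂ := fun k => a (k + 1) + (starRingEnd ℂ) (a (-(k + 1))) with hd
  have hdb : ∀ k, ‖d k‖ * ((k : ℝ) + 1) ^ 3 ≤ C3 + C3 := by
    intro k
    have h1 := hC3 (k + 1) (by positivity)
    have h2 := hC3 (-(k + 1)) (by rw [neg_ne_zero]; positivity)
    have hk : |((k : ℝ) + 1)| = k + 1 := abs_of_pos (by positivity)
    push_cast at h1 h2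
    rw [← ha] at h1 h2
    rw [abs_neg, hk] at h2
    rw [hk] at h1
    calc ‖d k‖ * ((k : ℝ) + 1) ^ 3
        ≤ (‖a (k + 1)‖ + ‖a (-(k + 1))‖) * ((k : ℝ) + 1) ^ 3 := by
          gcongr
          refine (norm_add_le _ _).trans ?_
          rw [RCLike.norm_conj]
      _ ≤ C3 + C3 := by linarith
  refine ⟨d, C3 + C3, hdb, fun θ => ?_⟩
  have hexp : ∀ k : ℕ, Complex.exp (2 * π * Complex.I * ((k + 1 : ℤ) : ℂ) * θ / ((π / 2 : ℝ) : ℂ))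
      = Complex.exp (θ * Complex.I) ^ (4 * k + 4) := by
    intro k
    rw [← Complex.exp_nat_mul]
    congr 1
    have : (π : ℂ) ≠ 0 := by exact_mod_cast Real.pi_ne_zero
    push_cast
    field_simp
    ring
  have hexp' : ∀ k : ℕ,
      Complex.exp (2 * π * Complex.I * ((-(k + 1) : ℤ) : ℂ) * θ / ((π / 2 : ℝ) : ℂ))
      = (starRingEnd ℂ) (Complex.exp (θ * Complex.I) ^ (4 * k + 4)) := by
    intro k
    rw [← hexp, ← Complex.exp_conj]
    congr 1
    simp only [map_div₀, map_mul, Complex.conj_ofReal, Complex.conj_I, Complex.conj_ofNat,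
      map_intCast]
    push_cast
    ring
  have hdS : Summable fun k => d k * Complex.exp (θ * Complex.I) ^ (4 * k + 4) := by
    have h1 : Summable fun k : ℕ => (C3 + C3) * (1 / ((k : ℝ) + 1) ^ 3) := by
      have := (summable_nat_add_iff 1).2 (Real.summable_one_div_nat_pow.2 (by norm_num : 1 < 3))
      push_cast at this
      exact this.mul_left _
    refine Summable.of_norm_bounded h1 fun k => ?_
    rw [norm_mul, norm_pow, Complex.norm_exp_ofReal_mul_I, one_pow, mul_one, mul_one_div,
      le_div_iff₀ (by positivity)]
    exact hdb k
  have hfin := Complex.hasSum_re hdS.hasSum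
  have hnat := (Complex.hasSum_re (hsum θ)).nat_add_neg
  rw [← ha, ← hasSum_nat_add_iff' 1] at hnat
  have hval : (h θ).re = g θ := rfl
  simp only [Int.cast_natCast, Finset.sum_range_one, Nat.cast_zero, neg_zero, Int.cast_zero, ha0,
    zero_mul, Complex.zero_re, add_zero, sub_zero, hval] at hnat
  refine HasSum.unique (hnat.congr_fun fun k => ?_) hfin
  have e1 := hexp k
  have e2 := hexp' k
  push_cast at e1 e2 ⊢
  rw [e1, e2, hd]
  simp only [add_mul, Complex.add_re, Complex.mul_re, Complex.conj_re, Complex.conj_im]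
  ring

lemma summable_norm_mul_weight {d : ℕ → ℂ} {C : ℝ}
    (hd : ∀ k, ‖d k‖ * ((k : ℝ) + 1) ^ 3 ≤ C) :
    Summable fun k : ℕ => ‖-d k / (8 * (k + 1))‖ * (2 * (((4 * k : ℕ) : ℝ) + 6) ^ 2) := by
  have h1 : Summable fun k : ℕ => 9 * C * (1 / ((k : ℝ) + 1) ^ 2) := by
    have := (summable_nat_add_iff 1).2 (Real.summable_one_div_nat_pow.2 one_lt_two)
    push_cast at this
    exact this.mul_left _
  refine Summable.of_nonneg_of_le (fun k => by positivity) (fun k => ?_) h1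
  have hk : ‖((k : ℂ) + 1)‖ = (k : ℝ) + 1 := by
    rw [← Nat.cast_add_one, Complex.norm_natCast]; push_cast; rfl
  have h6 : (((4 * k : ℕ) : ℝ) + 6) ≤ 6 * (k + 1) := by
    push_cast; nlinarith [(Nat.cast_nonneg k : (0 : ℝ) ≤ k)]
  rw [norm_div, norm_neg, norm_mul, hk, Complex.norm_ofNat, mul_one_div,
    le_div_iff₀ (by positivity)]
  calc ‖d k‖ / (8 * (k + 1)) * (2 * (((4 * k : ℕ) : ℝ) + 6) ^ 2) * ((k : ℝ) + 1) ^ 2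
      ≤ ‖d k‖ / (8 * (k + 1)) * (2 * (6 * (k + 1)) ^ 2) * ((k : ℝ) + 1) ^ 2 := by gcongr
    _ = 9 * (‖d k‖ * ((k : ℝ) + 1) ^ 3) := by field_simp; ring
    _ ≤ 9 * C := by linarith [hd k]

lemma HasFDerivAt.hasDerivAt_re_horizontal {f : ℂ → ℂ} {p q : ℂ} {x y : ℝ}
    (h : HasFDerivAt f (wirtinger p q) ⟨x, y⟩) :
    HasDerivAt (fun s : ℝ => (f ⟨s, y⟩).re) (p + q).re x := by
  have h1 : HasDerivAt (fun s : ℝ => (⟨s, y⟩ : ℂ)) 1 x := by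
    have := (Complex.ofRealCLM.hasDerivAt (x := x)).add_const (y * Complex.I)
    simpa [Complex.mk_eq_add_mul_I] using this
  have h2 := h.comp_hasDerivAt x h1
  have h3 := Complex.reCLM.hasFDerivAt.comp_hasDerivAt x h2
  exact h3.congr_deriv (by simp [wirtinger_apply])

lemma HasFDerivAt.hasDerivAt_re_vertical {f : ℂ → ℂ} {p q : ℂ} {x y : ℝ}
    (h : HasFDerivAt f (wirtinger p q) ⟨x, y⟩) :
    HasDerivAt (fun t : ℝ => (f ⟨x, t⟩).re) (Complex.I * (p - q)).re y := by
  have h1 : HasDerivAt (fun t : ℝ => (⟨x, t⟩ : ℂ)) Complex.I y := by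
    have := ((Complex.ofRealCLM.hasDerivAt (x := y)).mul_const Complex.I).const_add (x : ℂ)
    simpa [Complex.mk_eq_add_mul_I] using this
  have h2 := h.comp_hasDerivAt y h1
  have h3 := Complex.reCLM.hasFDerivAt.comp_hasDerivAt y h2
  refine h3.congr_deriv ?_
  rw [wirtinger_apply, Complex.conj_I, Complex.reCLM_apply]
  congr 1
  ring

namespace SecondOrderJet

variable {f p q pp pq qq : ℂ → ℂ} {U : Set ℂ} {x y : ℝ}

lemma eventually_mem_horizontal (hU : IsOpen U) (hz : (⟨x, y⟩ : ℂ) ∈ U) :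
    ∀ᶠ s in nhds x, (⟨s, y⟩ : ℂ) ∈ U := by
  have : Continuous fun s : ℝ => (⟨s, y⟩ : ℂ) := by
    simp only [Complex.mk_eq_add_mul_I]; fun_prop
  exact this.continuousAt.eventually (hU.mem_nhds hz)

lemma eventually_mem_vertical (hU : IsOpen U) (hz : (⟨x, y⟩ : ℂ) ∈ U) :
    ∀ᶠ t in nhds y, (⟨x, t⟩ : ℂ) ∈ U := by
  have : Continuous fun t : ℝ => (⟨x, t⟩ : ℂ) := by
    simp only [Complex.mk_eq_add_mul_I]; fun_prop
  exact this.continuousAt.eventually (hU.mem_nhds hz)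

lemma hasFDerivAt_add (h : SecondOrderJet f p q pp pq qq U) {z : ℂ} (hz : z ∈ U) :
    HasFDerivAt (fun w => p w + q w) (wirtinger (pp z + pq z) (pq z + qq z)) z :=
  (h.hasFDerivAt_d z hz).add_wirtinger (h.hasFDerivAt_dbar z hz)

lemma hasFDerivAt_I_mul_sub (h : SecondOrderJet f p q pp pq qq U) {z : ℂ} (hz : z ∈ U) :
    HasFDerivAt (fun w => Complex.I * (p w - q w))
      (wirtinger (Complex.I * (pp z - pq z)) (Complex.I * (pq z - qq z))) z := by
  have := ((h.hasFDerivAt_d z hz).add_wirtinger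
    ((h.hasFDerivAt_dbar z hz).const_mul_wirtinger (-1))).const_mul_wirtinger Complex.I
  simpa only [neg_mul, one_mul, ← sub_eq_add_neg] using this

lemma deriv_horizontal (h : SecondOrderJet f p q pp pq qq U) (hz : (⟨x, y⟩ : ℂ) ∈ U) :
    deriv (fun s : ℝ => (f ⟨s, y⟩).re) x = (p ⟨x, y⟩ + q ⟨x, y⟩).re :=
  (h.hasFDerivAt _ hz).hasDerivAt_re_horizontal.deriv

lemma deriv_vertical (h : SecondOrderJet f p q pp pq qq U) (hz : (⟨x, y⟩ : ℂ) ∈ U) :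
    deriv (fun t : ℝ => (f ⟨x, t⟩).re) y = (Complex.I * (p ⟨x, y⟩ - q ⟨x, y⟩)).re :=
  (h.hasFDerivAt _ hz).hasDerivAt_re_vertical.deriv

lemma deriv_horizontal_horizontal (h : SecondOrderJet f p q pp pq qq U) (hU : IsOpen U)
    (hz : (⟨x, y⟩ : ℂ) ∈ U) :
    deriv (fun s => deriv (fun s' : ℝ => (f ⟨s', y⟩).re) s) x =
      (pp ⟨x, y⟩ + 2 * pq ⟨x, y⟩ + qq ⟨x, y⟩).re := by
  have e : (fun s => deriv (fun s' : ℝ => (f ⟨s', y⟩).re) s) =ᶠ[nhds x]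
      fun s => (p ⟨s, y⟩ + q ⟨s, y⟩).re :=
    (eventually_mem_horizontal hU hz).mono fun s hs => h.deriv_horizontal hs
  rw [e.deriv_eq, (h.hasFDerivAt_add hz).hasDerivAt_re_horizontal.deriv]
  congr 1
  ring

lemma deriv_vertical_vertical (h : SecondOrderJet f p q pp pq qq U) (hU : IsOpen U)
    (hz : (⟨x, y⟩ : ℂ) ∈ U) :
    deriv (deriv fun t : ℝ => (f ⟨x, t⟩).re) y =
      (-(pp ⟨x, y⟩ - 2 * pq ⟨x, y⟩ + qq ⟨x, y⟩)).re := by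
  have e : (deriv fun t : ℝ => (f ⟨x, t⟩).re) =ᶠ[nhds y]
      fun t => (Complex.I * (p ⟨x, t⟩ - q ⟨x, t⟩)).re :=
    (eventually_mem_vertical hU hz).mono fun t ht => h.deriv_vertical ht
  rw [e.deriv_eq, (h.hasFDerivAt_I_mul_sub hz).hasDerivAt_re_vertical.deriv]
  congr 1
  linear_combination (pp ⟨x, y⟩ - 2 * pq ⟨x, y⟩ + qq ⟨x, y⟩) * Complex.I_mul_I

lemma deriv_horizontal_vertical (h : SecondOrderJet f p q pp pq qq U) (hU : IsOpen U)
    (hz : (⟨x, y⟩ : ℂ) ∈ U) :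
    deriv (fun s => deriv (fun t : ℝ => (f ⟨s, t⟩).re) y) x =
      (Complex.I * (pp ⟨x, y⟩ - qq ⟨x, y⟩)).re := by
  have e : (fun s => deriv (fun t : ℝ => (f ⟨s, t⟩).re) y) =ᶠ[nhds x]
      fun s => (Complex.I * (p ⟨s, y⟩ - q ⟨s, y⟩)).re :=
    (eventually_mem_horizontal hU hz).mono fun s hs => h.deriv_vertical hs
  rw [e.deriv_eq, (h.hasFDerivAt_I_mul_sub hz).hasDerivAt_re_horizontal.deriv]
  congr 1
  ring

lemma deriv_vertical_horizontal (h : SecondOrderJet f p q pp pq qq U) (hU : IsOpen U)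
    (hz : (⟨x, y⟩ : ℂ) ∈ U) :
    deriv (fun t => deriv (fun s : ℝ => (f ⟨s, t⟩).re) x) y =
      (Complex.I * (pp ⟨x, y⟩ - qq ⟨x, y⟩)).re := by
  have e : (fun t => deriv (fun s : ℝ => (f ⟨s, t⟩).re) x) =ᶠ[nhds y]
      fun t => (p ⟨x, t⟩ + q ⟨x, t⟩).re :=
    (eventually_mem_vertical hU hz).mono fun t ht => h.deriv_horizontal ht
  rw [e.deriv_eq, (h.hasFDerivAt_add hz).hasDerivAt_re_vertical.deriv]
  congr 1
  ring

lemma contDiffOn_re (h : SecondOrderJet f p q pp pq qq U) (hU : IsOpen U) :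
    ContDiffOn ℝ 2 (fun v : ℝ × ℝ => (f ⟨v.1, v.2⟩).re) {v | (⟨v.1, v.2⟩ : ℂ) ∈ U} := by
  have h1 : ContDiff ℝ 2 fun v : ℝ × ℝ => (⟨v.1, v.2⟩ : ℂ) :=
    Complex.equivRealProdCLM.symm.contDiff
  exact Complex.reCLM.contDiff.comp_contDiffOn
    ((h.contDiffOn hU).comp h1.contDiffOn fun v hv => hv)

end SecondOrderJet

lemma exists_abs_le_mul_of_contDiffOn {fbar : ℝ → ℝ} (h : ContDiffOn ℝ (⊤ : ℕ∞) fbar (Icc 0 1))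
    (h0 : fbar 0 = 0) : ∃ L, 0 ≤ L ∧ ∀ s ∈ Icc (0 : ℝ) 1, |fbar s| ≤ L * s := by
  obtain ⟨K, hK⟩ := (h.of_le (m := 1) (by exact_mod_cast le_top)).locallyLipschitzOn (convex_Icc 0 1)
    |>.exists_lipschitzOnWith_of_compact isCompact_Icc
  refine ⟨K, K.2, fun s hs => ?_⟩
  have := hK.dist_le_mul s hs 0 (by simp)
  simpa [Real.dist_eq, h0, abs_of_nonneg hs.1] using this

lemma ConcaveOn.mul_le_mul_of_zero {fbar : ℝ → ℝ} (h : ConcaveOn ℝ (Icc 0 1) fbar)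
    (h0 : fbar 0 = 0) {r s : ℝ} (hr : 0 ≤ r) (hrs : r ≤ s) (hs : s ≤ 1) :
    r * fbar s ≤ s * fbar r := by
  rcases (hr.trans hrs).eq_or_lt with rfl | hs0
  · simp [le_antisymm hrs hr]
  have hrs1 : 0 ≤ 1 - r / s := by rwa [sub_nonneg, div_le_one hs0]
  have := h.2 (show s ∈ Icc (0 : ℝ) 1 from ⟨hs0.le, hs⟩) (left_mem_Icc.2 zero_le_one)
    (div_nonneg hr hs0.le) hrs1 (by ring)
  simp only [smul_eq_mul, h0, mul_zero, add_zero] at this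
  rw [div_mul_cancel₀ _ hs0.ne', div_mul_eq_mul_div, div_le_iff₀ hs0] at this
  linarith

/-- A profile bounded by a concave function vanishing at the endpoints extends to the whole line. -/
lemma exists_extension_linearlyDominated {f fbar : ℝ → ℝ}
    (hsm : ContDiffOn ℝ (⊤ : ℕ∞) fbar (Icc 0 1)) (hconc : ConcaveOn ℝ (Icc 0 1) fbar)
    (h0 : fbar 0 = 0) (h1 : fbar 1 = 0) (hf : ContinuousOn f (Icc 0 1))
    (hff : ∀ r ∈ Icc (0 : ℝ) 1, |f r| ≤ fbar r) :
    ∃ (F : ℝ → ℝ) (L : ℝ), Continuous F ∧ (∀ r ∈ Icc (0 : ℝ) 1, F r = f r) ∧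
      (∀ s ∈ Icc (0 : ℝ) 2, |F s| ≤ L * s) ∧
      ∀ r ∈ Icc (0 : ℝ) 1, LinearlyDominated F r (sSup (fbar '' Icc 0 r)) := by
  obtain ⟨L, hL0, hL⟩ := exists_abs_le_mul_of_contDiffOn hsm h0
  have hmem : ∀ r ∈ Icc (0 : ℝ) 1, IccExtend zero_le_one ((Icc (0 : ℝ) 1).domRestrict f) r = f r :=
    fun r hr => IccExtend_of_mem _ _ hr
  have hge : ∀ r, 1 ≤ r → IccExtend zero_le_one ((Icc (0 : ℝ) 1).domRestrict f) r = 0 := by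
    intro r hr
    rw [IccExtend_of_right_le _ _ hr]
    have := hff 1 (by simp)
    rw [h1] at this
    exact abs_nonpos_iff.1 this
  refine ⟨_, L, hf.domRestrict.Icc_extend', hmem, fun s hs => ?_, fun r hr => ?_⟩
  · rcases le_total s 1 with h | h
    · rw [hmem s ⟨hs.1, h⟩]
      exact (hff s ⟨hs.1, h⟩).trans ((le_abs_self _).trans (hL s ⟨hs.1, h⟩))
    · rw [hge s h, abs_zero]
      exact mul_nonneg hL0 hs.1
  · have hbdd : BddAbove (fbar '' Icc 0 r) :=
      (isCompact_Icc.image_of_continuousOn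
        (hsm.continuousOn.mono (Icc_subset_Icc_right hr.2))).bddAbove
    have hle : ∀ s ∈ Icc 0 r, fbar s ≤ sSup (fbar '' Icc 0 r) := fun s hs =>
      le_csSup hbdd (mem_image_of_mem _ hs)
    have hK0 : 0 ≤ sSup (fbar '' Icc 0 r) := h0.ge.trans (hle 0 ⟨le_rfl, hr.1⟩)
    refine ⟨fun s hs => ?_, fun s hs => ?_⟩
    · have hs1 : s ∈ Icc (0 : ℝ) 1 := ⟨hs.1, hs.2.trans hr.2⟩
      rw [hmem s hs1]
      exact (hff s hs1).trans (hle s hs)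
    · have hs0 := hr.1.trans hs.1
      rcases le_total s 1 with h | h
      · rw [hmem s ⟨hs0, h⟩]
        calc r * |f s| ≤ r * fbar s := mul_le_mul_of_nonneg_left (hff s ⟨hs0, h⟩) hr.1
          _ ≤ s * fbar r := hconc.mul_le_mul_of_zero h0 hr.1 hs.1 h
          _ ≤ sSup (fbar '' Icc 0 r) * s := by
            rw [mul_comm]
            exact mul_le_mul_of_nonneg_right (hle r ⟨hr.1, le_rfl⟩) hs0
      · rw [hge s h, abs_zero, mul_zero]
        exact mul_nonneg hK0 hs0

lemma abs_add_two_mul_add_re_le {a b c : ℂ} {B : ℝ} (ha : ‖a‖ ≤ B) (hb : ‖b‖ ≤ B) (hc : ‖c‖ ≤ B) :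
    |(a + 2 * b + c).re| ≤ 4 * B := by
  have h2 : ‖2 * b‖ = 2 * ‖b‖ := by simp
  have := Complex.abs_re_le_norm (a + 2 * b + c)
  have := norm_add₃_le (a := a) (b := 2 * b) (c := c)
  linarith

lemma abs_I_mul_sub_re_le {a b : ℂ} {B : ℝ} (ha : ‖a‖ ≤ B) (hb : ‖b‖ ≤ B) :
    |(Complex.I * (a - b)).re| ≤ 2 * B := by
  have := Complex.abs_re_le_norm (Complex.I * (a - b))
  rw [norm_mul, Complex.norm_I, one_mul] at this
  have := norm_sub_le a b
  linarith

lemma tsum_mul_modeDDbar {d : ℕ → ℂ} {F : ℝ → ℝ} {z : ℂ} {θ : ℝ}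
    (hz : z / ‖z‖ = Complex.exp (θ * Complex.I)) :
    4 * ∑' k : ℕ, -d k / (8 * (k + 1)) * modeDDbar (4 * k) F z =
      F ‖z‖ * ∑' k, d k * Complex.exp (θ * Complex.I) ^ (4 * k + 4) := by
  rw [← tsum_mul_left, ← tsum_mul_left]
  refine tsum_congr fun k => ?_
  have hk : (k : ℂ) + 1 ≠ 0 := Nat.cast_add_one_ne_zero k
  rw [modeDDbar, hz]
  push_cast
  field_simp
  ring

theorem stmt1
    (g : ℝ → ℝ) (hg_smooth : ContDiff ℝ (⊤ : ℕ∞) g)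
    (hg_per : ∀ θ : ℝ, g (θ + π / 2) = g θ)
    (hg_mean : ∫ θ in (0:ℝ)..(π/2), g θ = 0) :
    ∃ C > (0:ℝ), ∀ (fbar : ℝ → ℝ),
      ContDiffOn ℝ (⊤ : ℕ∞) fbar (Set.Icc 0 1) →
      (∀ r ∈ Set.Icc (0:ℝ) 1, 0 ≤ fbar r) →
      ConcaveOn ℝ (Set.Icc 0 1) fbar →
      fbar 0 = 0 → fbar 1 = 0 →
      Filter.Tendsto (fun r => r * deriv fbar r) (nhdsWithin 0 (Set.Ioi 0)) (nhds 0) →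
      ∀ (f : ℝ → ℝ), ContinuousOn f (Set.Icc 0 1) →
      (∀ r ∈ Set.Icc (0:ℝ) 1, |f r| ≤ fbar r) →
      ∃ ψ : ℝ → ℝ → ℝ,
        ContDiffOn ℝ 2 (fun p : ℝ × ℝ => ψ p.1 p.2) {p : ℝ × ℝ | p.1 ^ 2 + p.2 ^ 2 ≤ 1} ∧
        (∀ x₁ x₂ : ℝ, 0 < Real.sqrt (x₁ ^ 2 + x₂ ^ 2) → Real.sqrt (x₁ ^ 2 + x₂ ^ 2) ≤ 1 →
          ∀ θ : ℝ, x₁ = Real.sqrt (x₁ ^ 2 + x₂ ^ 2) * Real.cos θ →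
            x₂ = Real.sqrt (x₁ ^ 2 + x₂ ^ 2) * Real.sin θ →
            deriv (fun s => deriv (fun s' => ψ s' x₂) s) x₁
              + deriv (deriv (ψ x₁)) x₂
              = f (Real.sqrt (x₁ ^ 2 + x₂ ^ 2)) * g θ) ∧
        (∀ x₁ x₂ : ℝ, Real.sqrt (x₁ ^ 2 + x₂ ^ 2) ≤ 1 →
          -- M(|x|)
          (|ψ x₁ x₂| ≤ C * Real.sqrt (x₁ ^ 2 + x₂ ^ 2) ^ 2 *
              (sSup (fbar '' Set.Icc 0 (Real.sqrt (x₁ ^ 2 + x₂ ^ 2)))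
                + sSup ((fun τ => τ * deriv fbar τ) '' Set.Icc 0 (Real.sqrt (x₁ ^ 2 + x₂ ^ 2))))) ∧
          (|deriv (fun s => ψ s x₂) x₁| ≤ C * Real.sqrt (x₁ ^ 2 + x₂ ^ 2) *
              (sSup (fbar '' Set.Icc 0 (Real.sqrt (x₁ ^ 2 + x₂ ^ 2)))
                + sSup ((fun τ => τ * deriv fbar τ) '' Set.Icc 0 (Real.sqrt (x₁ ^ 2 + x₂ ^ 2))))) ∧
          (|deriv (ψ x₁) x₂| ≤ C * Real.sqrt (x₁ ^ 2 + x₂ ^ 2) *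
              (sSup (fbar '' Set.Icc 0 (Real.sqrt (x₁ ^ 2 + x₂ ^ 2)))
                + sSup ((fun τ => τ * deriv fbar τ) '' Set.Icc 0 (Real.sqrt (x₁ ^ 2 + x₂ ^ 2))))) ∧
          (|deriv (fun s => deriv (fun s' => ψ s' x₂) s) x₁| ≤ C *
              (sSup (fbar '' Set.Icc 0 (Real.sqrt (x₁ ^ 2 + x₂ ^ 2)))
                + sSup ((fun τ => τ * deriv fbar τ) '' Set.Icc 0 (Real.sqrt (x₁ ^ 2 + x₂ ^ 2))))) ∧
          (|deriv (fun s => deriv (ψ s) x₂) x₁| ≤ C *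
              (sSup (fbar '' Set.Icc 0 (Real.sqrt (x₁ ^ 2 + x₂ ^ 2)))
                + sSup ((fun τ => τ * deriv fbar τ) '' Set.Icc 0 (Real.sqrt (x₁ ^ 2 + x₂ ^ 2))))) ∧
          (|deriv (fun t => deriv (fun s => ψ s t) x₁) x₂| ≤ C *
              (sSup (fbar '' Set.Icc 0 (Real.sqrt (x₁ ^ 2 + x₂ ^ 2)))
                + sSup ((fun τ => τ * deriv fbar τ) '' Set.Icc 0 (Real.sqrt (x₁ ^ 2 + x₂ ^ 2))))) ∧
          (|deriv (deriv (ψ x₁)) x₂| ≤ C *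
              (sSup (fbar '' Set.Icc 0 (Real.sqrt (x₁ ^ 2 + x₂ ^ 2)))
                + sSup ((fun τ => τ * deriv fbar τ) '' Set.Icc 0 (Real.sqrt (x₁ ^ 2 + x₂ ^ 2)))))) := by
  obtain ⟨d, D, hdD, hgd⟩ := exists_fourier_expansion hg_smooth hg_per hg_mean
  have hcs := summable_norm_mul_weight hdD
  set S := ∑' k : ℕ, ‖-d k / (8 * (k + 1))‖ * (2 * (((4 * k : ℕ) : ℝ) + 6) ^ 2) with hS
  have hS0 : 0 ≤ S := tsum_nonneg fun k => by positivity
  refine ⟨4 * S + 1, by positivity, ?_⟩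
  intro fbar hsm _ hconc h0 h1 _ f hf hff
  obtain ⟨F, L, hFc, hFf, hFL, hFK⟩ :=
    exists_extension_linearlyDominated hsm hconc h0 h1 hf hff
  obtain ⟨Φ, p, q, pp, pq, qq, hjet, hpq, hbd⟩ :=
    exists_secondOrderJet (c := fun k => -d k / (8 * (k + 1))) (fun _ => rfl) hcs hFc hFL
  rw [← hS] at hbd
  have hU : IsOpen (Metric.ball (0 : ℂ) 2) := Metric.isOpen_ball
  have hnorm : ∀ x y : ℝ, ‖(⟨x, y⟩ : ℂ)‖ = √(x ^ 2 + y ^ 2) := fun x y => by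
    rw [Complex.norm_def, Complex.normSq_mk, sq, sq]
  have hmem : ∀ x y : ℝ, √(x ^ 2 + y ^ 2) ≤ 1 → (⟨x, y⟩ : ℂ) ∈ Metric.ball (0 : ℂ) 2 := by
    intro x y h
    rw [mem_ball_zero_iff, hnorm]
    linarith
  refine ⟨fun x y => (Φ ⟨x, y⟩).re, ?_, ?_, ?_⟩
  · refine (hjet.contDiffOn_re hU).mono fun v hv => hmem _ _ ?_
    exact Real.sqrt_le_one.2 hv
  · intro x y hr0 hr1 θ hx hy
    have hz := hmem x y hr1
    rw [hjet.deriv_horizontal_horizontal hU hz, hjet.deriv_vertical_vertical hU hz,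
      ← Complex.add_re]
    have hpolar : (⟨x, y⟩ : ℂ) / (‖(⟨x, y⟩ : ℂ)‖ : ℂ) = Complex.exp (θ * Complex.I) := by
      have hr : ((√(x ^ 2 + y ^ 2) : ℝ) : ℂ) ≠ 0 := by exact_mod_cast hr0.ne'
      rw [hnorm, div_eq_iff hr, Complex.exp_mul_I, Complex.mk_eq_add_mul_I]
      nth_rewrite 1 [hx]
      nth_rewrite 2 [hy]
      push_cast
      ring
    have h4 : pp ⟨x, y⟩ + 2 * pq ⟨x, y⟩ + qq ⟨x, y⟩ + -(pp ⟨x, y⟩ - 2 * pq ⟨x, y⟩ + qq ⟨x, y⟩) =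
        4 * pq ⟨x, y⟩ := by ring
    rw [h4, hpq, tsum_mul_modeDDbar hpolar, Complex.re_ofReal_mul, ← hgd, hnorm,
      hFf _ ⟨hr0.le, hr1⟩]
  · intro x y hr1
    have hz := hmem x y hr1
    have hr0 := Real.sqrt_nonneg (x ^ 2 + y ^ 2)
    have hK := hFK _ ⟨hr0, hr1⟩
    have hK0 := hK.nonneg hr0
    have hM : 0 ≤ sSup ((fun τ => τ * deriv fbar τ) '' Icc 0 √(x ^ 2 + y ^ 2)) :=
      Real.sSup_nonneg' ⟨0, ⟨0, ⟨le_rfl, hr0⟩, by simp⟩, le_rfl⟩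
    have hb := hbd ⟨x, y⟩ (sSup (fbar '' Icc 0 √(x ^ 2 + y ^ 2))) (mem_ball_zero_iff.1 hz).le
    rw [hnorm x y] at hb
    obtain ⟨b, bp, bq, bpp, bpq, bqq⟩ := hb hK
    rw [hjet.deriv_horizontal hz, hjet.deriv_vertical hz, hjet.deriv_horizontal_horizontal hU hz,
      hjet.deriv_vertical_vertical hU hz, hjet.deriv_horizontal_vertical hU hz,
      hjet.deriv_vertical_horizontal hU hz]
    set r := √(x ^ 2 + y ^ 2)
    set K := sSup (fbar '' Icc 0 r)
    set K' := sSup ((fun τ => τ * deriv fbar τ) '' Icc 0 r)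
    have key : ∀ {v ρ : ℝ}, 0 ≤ ρ → v ≤ 4 * (S * (K * ρ)) → v ≤ (4 * S + 1) * ρ * (K + K') := by
      intro v ρ hρ hv
      have h1 : 0 ≤ S * ρ * K' := by positivity
      have h2 : 0 ≤ ρ * (K + K') := by positivity
      linarith
    have key₁ : ∀ {v : ℝ}, v ≤ 4 * (S * K) → v ≤ (4 * S + 1) * (K + K') := by
      intro v hv
      have := key zero_le_one (hv.trans_eq (by rw [mul_one]))
      rwa [mul_one] at this
    have hSK : 0 ≤ S * K := mul_nonneg hS0 hK0
    refine ⟨key (by positivity) ?_, key hr0 ?_, key hr0 ?_, key₁ ?_, key₁ ?_, key₁ ?_, key₁ ?_⟩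
    · have : 0 ≤ S * (K * r ^ 2) := by positivity
      exact (Complex.abs_re_le_norm _).trans (by linarith)
    · have : 0 ≤ S * (K * r) := by positivity
      linarith [Complex.abs_re_le_norm (p ⟨x, y⟩ + q ⟨x, y⟩), norm_add_le (p ⟨x, y⟩) (q ⟨x, y⟩)]
    · have : 0 ≤ S * (K * r) := by positivity
      linarith [abs_I_mul_sub_re_le bp bq]
    · exact abs_add_two_mul_add_re_le bpp bpq bqq
    · linarith [abs_I_mul_sub_re_le bpp bqq]
    · linarith [abs_I_mul_sub_re_le bpp bqq]
    · rw [Complex.neg_re, abs_neg, sub_eq_add_neg, ← mul_neg]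
      exact abs_add_two_mul_add_re_le bpp ((norm_neg _).trans_le bpq) bqq
end
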